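/- arXiv:math/0608232 — 2 statements merged into one kernel-verified Lean document; each statement's English description precedes it below -/
import Mathlib

section
/- Let n ≥ 1 and let v, w ∈ S_n. For any reduced word (i_1, …, i_l) of w (i.e., w = s_{i_1}⋯s_{i_l} with l = ℓ(w)), one has π_{i_1}∘π_{i_2}∘⋯∘π_{i_l}(𝔊_v) = 1 if and only if v ≤ w in the (strong) Bruhat order on S_n. -/
open MvPolynomial

noncomputable section

/-- The number of inversions of a permutation of `{0, …, n−1}`, i.e. its Coxeter length. -/
def len (n : ℕ) (w : Equiv.Perm (Fin n)) : ℕ :=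
  ((Finset.univ : Finset (Fin n × Fin n)).filter fun p => p.1 < p.2 ∧ w p.2 < w p.1).card

/-- The simple reflection `s_i`, the adjacent transposition swapping positions `i` and `i+1`
(`0`-based). -/
def simpleRefl (n : ℕ) (i : Fin (n - 1)) : Equiv.Perm (Fin n) :=
  Equiv.swap ⟨(i : ℕ), by have := i.isLt; omega⟩ ⟨(i : ℕ) + 1, by have := i.isLt; omega⟩

/-- `L` is a reduced word for `w`: `w = s_{i_1}⋯s_{i_l}` with `l = ℓ(w)`. -/
def IsReducedWord (n : ℕ) (L : List (Fin (n - 1))) (w : Equiv.Perm (Fin n)) : Prop :=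
  (L.map (simpleRefl n)).prod = w ∧ L.length = len n w

/-- `D` is the family of divided difference operators: for each `i`,
`(x_i − x_{i+1})·D_i(f) = f − s_i(f)`, where `s_i` swaps the variables `x_i` and `x_{i+1}`.
(This property determines `D_i(f)` uniquely.) -/
def IsDividedDifference (n : ℕ)
    (D : Fin (n - 1) → MvPolynomial (Fin n) ℤ → MvPolynomial (Fin n) ℤ) : Prop :=
  ∀ (i : Fin (n - 1)) (f : MvPolynomial (Fin n) ℤ),
    (X (⟨(i : ℕ), by have := i.isLt; omega⟩ : Fin n)
        - X (⟨(i : ℕ) + 1, by have := i.isLt; omega⟩ : Fin n)) * D i f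
      = f - rename (Equiv.swap (⟨(i : ℕ), by have := i.isLt; omega⟩ : Fin n)
          (⟨(i : ℕ) + 1, by have := i.isLt; omega⟩ : Fin n)) f

/-- The isobaric divided difference operator `π_i(f) = f + (1 − x_i)·D_i(f)`. -/
def piOp (n : ℕ) (D : Fin (n - 1) → MvPolynomial (Fin n) ℤ → MvPolynomial (Fin n) ℤ)
    (i : Fin (n - 1)) (f : MvPolynomial (Fin n) ℤ) : MvPolynomial (Fin n) ℤ :=
  f + (1 - X (⟨(i : ℕ), by have := i.isLt; omega⟩ : Fin n)) * D i f

/-- The composition `π_{i_1}∘π_{i_2}∘⋯∘π_{i_l}` applied to `f`, for `L = (i_1, …, i_l)`. -/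
def applyPis (n : ℕ) (D : Fin (n - 1) → MvPolynomial (Fin n) ℤ → MvPolynomial (Fin n) ℤ)
    (L : List (Fin (n - 1))) (f : MvPolynomial (Fin n) ℤ) : MvPolynomial (Fin n) ℤ :=
  L.foldr (piOp n D) f

/-- `𝔊_{w₀} = x_1^{n−1}·x_2^{n−2}·⋯·x_{n−1}` (`0`-based variables). -/
def Gw0 (n : ℕ) : MvPolynomial (Fin n) ℤ :=
  ∏ i : Fin n, X i ^ (n - 1 - (i : ℕ))

/-- The covering relation of the Bruhat order: `w = v·t_{ab}` with `ℓ(w) = ℓ(v) + 1`. -/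
def BruhatCov (n : ℕ) (v w : Equiv.Perm (Fin n)) : Prop :=
  ∃ a b : Fin n, a ≠ b ∧ w = v * Equiv.swap a b ∧ len n w = len n v + 1

/-- The (strong) Bruhat order on `S_n`: the reflexive-transitive closure of the covering
relation. -/
def BruhatLE (n : ℕ) (v w : Equiv.Perm (Fin n)) : Prop :=
  Relation.ReflTransGen (BruhatCov n) v w

section SymmetricGroup

variable {n : ℕ}

/-- The first of the two positions exchanged by `simpleRefl n i`. -/
def lo (i : Fin (n - 1)) : Fin n := ⟨(i : ℕ), by have := i.isLt; omega⟩

/-- The second of the two positions exchanged by `simpleRefl n i`. -/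
def hi (i : Fin (n - 1)) : Fin n := ⟨(i : ℕ) + 1, by have := i.isLt; omega⟩

lemma val_lo (i : Fin (n - 1)) : (lo i : ℕ) = i := rfl

lemma val_hi (i : Fin (n - 1)) : (hi i : ℕ) = i + 1 := rfl

lemma lo_lt_hi (i : Fin (n - 1)) : lo i < hi i := by
  rw [Fin.lt_def, val_lo, val_hi]; omega

lemma simpleRefl_eq_swap (i : Fin (n - 1)) : simpleRefl n i = Equiv.swap (lo i) (hi i) := rfl

lemma simpleRefl_mul_self (i : Fin (n - 1)) : simpleRefl n i * simpleRefl n i = 1 :=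
  Equiv.swap_mul_self _ _

lemma simpleRefl_inv (i : Fin (n - 1)) : (simpleRefl n i)⁻¹ = simpleRefl n i :=
  Equiv.swap_inv _ _

lemma simpleRefl_simpleRefl (i : Fin (n - 1)) (a : Fin n) :
    simpleRefl n i (simpleRefl n i a) = a :=
  Equiv.congr_fun (simpleRefl_mul_self i) a

lemma mul_simpleRefl_cancel (w : Equiv.Perm (Fin n)) (i : Fin (n - 1)) :
    w * simpleRefl n i * simpleRefl n i = w := by
  rw [mul_assoc, simpleRefl_mul_self, mul_one]

lemma simpleRefl_lo (i : Fin (n - 1)) : simpleRefl n i (lo i) = hi i :=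
  Equiv.swap_apply_left _ _

lemma simpleRefl_hi (i : Fin (n - 1)) : simpleRefl n i (hi i) = lo i :=
  Equiv.swap_apply_right _ _

lemma simpleRefl_apply_of_ne {i : Fin (n - 1)} {a : Fin n} (h₁ : a ≠ lo i) (h₂ : a ≠ hi i) :
    simpleRefl n i a = a :=
  Equiv.swap_apply_of_ne_of_ne h₁ h₂

lemma simpleRefl_lt_simpleRefl_iff {i : Fin (n - 1)} {a b : Fin n}
    (h₁ : ¬(a = lo i ∧ b = hi i)) (h₂ : ¬(a = hi i ∧ b = lo i)) :
    simpleRefl n i a < simpleRefl n i b ↔ a < b := by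
  simp only [simpleRefl_eq_swap, Equiv.swap_apply_def]
  split_ifs <;> simp only [Fin.ext_iff, Fin.lt_def, val_lo, val_hi] at * <;> omega

lemma len_mul_simpleRefl_of_lt {w : Equiv.Perm (Fin n)} {i : Fin (n - 1)}
    (h : w (lo i) < w (hi i)) : len n (w * simpleRefl n i) = len n w + 1 := by
  have key : (Finset.univ.filter fun p : Fin n × Fin n =>
      p.1 < p.2 ∧ (w * simpleRefl n i) p.2 < (w * simpleRefl n i) p.1) =
      insert (lo i, hi i) ((Finset.univ.filter fun p : Fin n × Fin n =>
        p.1 < p.2 ∧ w p.2 < w p.1).map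
          ((simpleRefl n i).prodCongr (simpleRefl n i)).toEmbedding) := by
    ext ⟨a, b⟩
    rw [Finset.mem_filter]
    simp only [Finset.mem_filter, Finset.mem_univ, true_and, Finset.mem_insert,
      Finset.mem_map_equiv, Equiv.prodCongr_symm, Equiv.prodCongr_apply, Prod.map,
      Prod.mk.injEq, Equiv.Perm.mul_apply]
    have hs : Equiv.symm (simpleRefl n i) = simpleRefl n i := Equiv.symm_swap _ _
    rw [hs]
    by_cases h₁ : a = lo i ∧ b = hi i
    · obtain ⟨rfl, rfl⟩ := h₁
      simp [simpleRefl_lo, simpleRefl_hi, lo_lt_hi, h]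
    by_cases h₂ : a = hi i ∧ b = lo i
    · obtain ⟨rfl, rfl⟩ := h₂
      simp [simpleRefl_lo, simpleRefl_hi, (lo_lt_hi i).not_gt, (lo_lt_hi i).ne', h.le]
    rw [simpleRefl_lt_simpleRefl_iff h₁ h₂]
    simp [h₁]
  rw [len, key, Finset.card_insert_of_notMem, Finset.card_map, len]
  have hs : Equiv.symm (simpleRefl n i) = simpleRefl n i := Equiv.symm_swap _ _
  simp [Finset.mem_map_equiv, hs, simpleRefl_lo, simpleRefl_hi, (lo_lt_hi i).le]

lemma len_mul_simpleRefl_of_gt {w : Equiv.Perm (Fin n)} {i : Fin (n - 1)}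
    (h : w (hi i) < w (lo i)) : len n (w * simpleRefl n i) + 1 = len n w := by
  have := len_mul_simpleRefl_of_lt (w := w * simpleRefl n i) (i := i)
    (by simpa [simpleRefl_lo, simpleRefl_hi] using h)
  rw [← this, mul_simpleRefl_cancel]

lemma apply_lo_lt_or_gt (w : Equiv.Perm (Fin n)) (i : Fin (n - 1)) :
    w (lo i) < w (hi i) ∨ w (hi i) < w (lo i) :=
  lt_or_gt_of_ne (w.injective.ne (lo_lt_hi i).ne)

lemma len_mul_simpleRefl_le (w : Equiv.Perm (Fin n)) (i : Fin (n - 1)) :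
    len n (w * simpleRefl n i) ≤ len n w + 1 := by
  rcases apply_lo_lt_or_gt w i with h | h
  · exact (len_mul_simpleRefl_of_lt h).le
  · have := len_mul_simpleRefl_of_gt h; omega

lemma le_len_mul_simpleRefl (w : Equiv.Perm (Fin n)) (i : Fin (n - 1)) :
    len n w ≤ len n (w * simpleRefl n i) + 1 := by
  simpa [mul_simpleRefl_cancel] using len_mul_simpleRefl_le (w * simpleRefl n i) i

lemma lt_apply_of_len_lt {w : Equiv.Perm (Fin n)} {i : Fin (n - 1)}
    (h : len n w < len n (w * simpleRefl n i)) : w (lo i) < w (hi i) := by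
  rcases apply_lo_lt_or_gt w i with h' | h'
  · exact h'
  · have := len_mul_simpleRefl_of_gt h'; omega

lemma gt_apply_of_len_lt {w : Equiv.Perm (Fin n)} {i : Fin (n - 1)}
    (h : len n (w * simpleRefl n i) < len n w) : w (hi i) < w (lo i) := by
  rcases apply_lo_lt_or_gt w i with h' | h'
  · have := len_mul_simpleRefl_of_lt h'; omega
  · exact h'

lemma simpleRefl_conj_swap (i : Fin (n - 1)) (a b : Fin n) :
    simpleRefl n i * Equiv.swap a b * simpleRefl n i =
      Equiv.swap (simpleRefl n i a) (simpleRefl n i b) := by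
  have := Equiv.swap_apply_apply (simpleRefl n i) a b
  rw [this, simpleRefl_inv]

lemma len_lt_len_mul_swap {w : Equiv.Perm (Fin n)} {a b : Fin n} (hab : a < b)
    (h : w a < w b) : len n w < len n (w * Equiv.swap a b) := by
  obtain ⟨k, hk⟩ : ∃ k, (b : ℕ) = a + 1 + k := ⟨b - (a + 1), by rw [Fin.lt_def] at hab; omega⟩
  induction k generalizing w a with
  | zero =>
    have hb := b.isLt
    let i : Fin (n - 1) := ⟨a, by omega⟩
    have ha : a = lo i := rfl
    have hb' : b = hi i := Fin.ext (by rw [val_hi]; simpa using hk)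
    rw [ha, hb'] at h ⊢
    rw [← simpleRefl_eq_swap, len_mul_simpleRefl_of_lt h]
    omega
  | succ k ih =>
    have hb := b.isLt
    let i : Fin (n - 1) := ⟨a, by omega⟩
    have ha : a = lo i := rfl
    have hb₁ : b ≠ lo i := by rw [Ne, Fin.ext_iff, val_lo]; simp only [i]; omega
    have hb₂ : b ≠ hi i := by rw [Ne, Fin.ext_iff, val_hi]; simp only [i]; omega
    have hlt : hi i < b := by rw [Fin.lt_def, val_hi]; simp only [i]; omega
    have hsb := simpleRefl_apply_of_ne hb₁ hb₂
    have hconj : w * Equiv.swap a b =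
        w * simpleRefl n i * Equiv.swap (hi i) b * simpleRefl n i := by
      have := simpleRefl_conj_swap i (hi i) b
      rw [simpleRefl_hi, hsb, ← ha] at this
      rw [← this]; simp only [mul_assoc]
    have step := ih (w := w * simpleRefl n i) (a := hi i) hlt
      (by simpa [simpleRefl_hi, hsb, ← ha] using h)
      (by rw [val_hi]; simp only [i]; omega)
    rw [hconj]
    rcases apply_lo_lt_or_gt w i with h' | h'
    · have h₁ := len_mul_simpleRefl_of_lt h'
      have h₂ := le_len_mul_simpleRefl (w * simpleRefl n i * Equiv.swap (hi i) b) i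
      omega
    · have h₁ := len_mul_simpleRefl_of_gt h'
      have h₂ := len_mul_simpleRefl_of_lt (w := w * simpleRefl n i * Equiv.swap (hi i) b) (i := i)
        (by
          rw [Equiv.Perm.mul_apply, Equiv.Perm.mul_apply, Equiv.Perm.mul_apply,
            Equiv.Perm.mul_apply, Equiv.swap_apply_left, hsb,
            Equiv.swap_apply_of_ne_of_ne (lo_lt_hi i).ne (Ne.symm hb₁), simpleRefl_lo]
          exact h'.trans h)
      omega

lemma lt_apply_of_len_lt_len_mul_swap {w : Equiv.Perm (Fin n)} {a b : Fin n} (hab : a < b)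
    (h : len n w < len n (w * Equiv.swap a b)) : w a < w b := by
  by_contra hle
  have hlt : w b < w a := lt_of_le_of_ne (not_lt.mp hle) (w.injective.ne hab.ne')
  have := len_lt_len_mul_swap (w := w * Equiv.swap a b) hab (by simpa using hlt)
  rw [mul_assoc, Equiv.swap_mul_self, mul_one] at this
  omega

/-- Multiplying on the right by a simple reflection other than `swap a b` does not change the
direction of the reflection `swap a b`. -/
lemma len_mul_simpleRefl_lt_of_len_lt {w : Equiv.Perm (Fin n)} {a b : Fin n} {i : Fin (n - 1)}
    (hab : a < b) (hi : ¬(a = lo i ∧ b = hi i)) (h : len n w < len n (w * Equiv.swap a b)) :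
    len n (w * simpleRefl n i) < len n (w * Equiv.swap a b * simpleRefl n i) := by
  have hconj : w * Equiv.swap a b * simpleRefl n i = w * simpleRefl n i *
      Equiv.swap (simpleRefl n i a) (simpleRefl n i b) := by
    rw [← simpleRefl_conj_swap]
    simp only [← mul_assoc]
    rw [mul_simpleRefl_cancel]
  rw [hconj]
  refine len_lt_len_mul_swap ((simpleRefl_lt_simpleRefl_iff hi ?_).2 hab) ?_
  · rintro ⟨rfl, rfl⟩
    exact (lo_lt_hi i).not_gt hab
  · simpa [simpleRefl_simpleRefl] using lt_apply_of_len_lt_len_mul_swap hab h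

lemma BruhatLE.mul_simpleRefl_of_len_lt {w : Equiv.Perm (Fin n)} {i : Fin (n - 1)}
    (h : len n w < len n (w * simpleRefl n i)) : BruhatLE n w (w * simpleRefl n i) :=
  Relation.ReflTransGen.single
    ⟨lo i, hi i, (lo_lt_hi i).ne, rfl, len_mul_simpleRefl_of_lt (lt_apply_of_len_lt h)⟩

lemma BruhatLE.of_mul_simpleRefl_of_len_lt {w : Equiv.Perm (Fin n)} {i : Fin (n - 1)}
    (h : len n (w * simpleRefl n i) < len n w) : BruhatLE n (w * simpleRefl n i) w := by
  have := BruhatLE.mul_simpleRefl_of_len_lt (w := w * simpleRefl n i) (i := i)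
    (by rwa [mul_simpleRefl_cancel])
  rwa [mul_simpleRefl_cancel] at this

/-- The shorter of `w` and `w * simpleRefl n i`. -/
def lower (i : Fin (n - 1)) (w : Equiv.Perm (Fin n)) : Equiv.Perm (Fin n) :=
  if w (hi i) < w (lo i) then w * simpleRefl n i else w

/-- The longer of `w` and `w * simpleRefl n i`. -/
def upper (i : Fin (n - 1)) (w : Equiv.Perm (Fin n)) : Equiv.Perm (Fin n) :=
  if w (hi i) < w (lo i) then w else w * simpleRefl n i

lemma lower_mul_simpleRefl (i : Fin (n - 1)) (w : Equiv.Perm (Fin n)) :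
    lower i (w * simpleRefl n i) = lower i w := by
  rcases apply_lo_lt_or_gt w i with h | h
  · simp [lower, simpleRefl_lo, simpleRefl_hi, h, h.le, mul_simpleRefl_cancel]
  · simp [lower, simpleRefl_lo, simpleRefl_hi, h, h.le]

lemma upper_mul_simpleRefl (i : Fin (n - 1)) (w : Equiv.Perm (Fin n)) :
    upper i (w * simpleRefl n i) = upper i w := by
  rcases apply_lo_lt_or_gt w i with h | h
  · simp [upper, simpleRefl_lo, simpleRefl_hi, h, h.le]
  · simp [upper, simpleRefl_lo, simpleRefl_hi, h, h.le, mul_simpleRefl_cancel]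

lemma upper_lower (i : Fin (n - 1)) (w : Equiv.Perm (Fin n)) :
    upper i (lower i w) = upper i w := by
  unfold lower
  split_ifs
  · exact upper_mul_simpleRefl i w
  · rfl

lemma lower_bruhatLE (i : Fin (n - 1)) (w : Equiv.Perm (Fin n)) : BruhatLE n (lower i w) w := by
  unfold lower
  split_ifs with h
  · exact .of_mul_simpleRefl_of_len_lt (by have := len_mul_simpleRefl_of_gt h; omega)
  · exact .refl

lemma bruhatLE_upper (i : Fin (n - 1)) (w : Equiv.Perm (Fin n)) : BruhatLE n w (upper i w) := by
  rcases apply_lo_lt_or_gt w i with h | h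
  · rw [upper, if_neg h.not_gt]
    exact .mul_simpleRefl_of_len_lt (by have := len_mul_simpleRefl_of_lt h; omega)
  · rw [upper, if_pos h]
    exact .refl

/-- The lifting property along a covering relation. -/
lemma BruhatCov.lower_upper {v w : Equiv.Perm (Fin n)} (h : BruhatCov n v w) (i : Fin (n - 1)) :
    BruhatLE n (lower i v) (lower i w) ∧ BruhatLE n (upper i v) (upper i w) := by
  have hle : BruhatLE n v w := .single h
  obtain ⟨a, b, hab, rfl, hlen⟩ := h
  wlog hlt : a < b generalizing a b
  · rw [Equiv.swap_comm] at hlen hle ⊢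
    exact this b a hab.symm hle hlen (lt_of_le_of_ne (not_lt.mp hlt) hab.symm)
  by_cases his : a = lo i ∧ b = hi i
  · obtain ⟨rfl, rfl⟩ := his
    rw [← simpleRefl_eq_swap, lower_mul_simpleRefl, upper_mul_simpleRefl]
    exact ⟨.refl, .refl⟩
  have hmono := len_mul_simpleRefl_lt_of_len_lt (w := v) hlt his (by omega)
  have hcov (hl : len n (v * Equiv.swap a b * simpleRefl n i) =
      len n (v * simpleRefl n i) + 1) :
      BruhatLE n (v * simpleRefl n i) (v * Equiv.swap a b * simpleRefl n i) := by
    refine .single ⟨simpleRefl n i a, simpleRefl n i b, (simpleRefl n i).injective.ne hab, ?_, hl⟩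
    rw [← simpleRefl_conj_swap]
    simp only [← mul_assoc]
    rw [mul_simpleRefl_cancel]
  rcases apply_lo_lt_or_gt v i with hv | hv <;>
    rcases apply_lo_lt_or_gt (v * Equiv.swap a b) i with hw | hw
  · have h₁ := len_mul_simpleRefl_of_lt hv
    have h₂ := len_mul_simpleRefl_of_lt hw
    rw [lower, lower, upper, upper, if_neg hv.not_gt, if_neg hw.not_gt, if_neg hv.not_gt,
      if_neg hw.not_gt]
    exact ⟨hle, hcov (by omega)⟩
  · have h₁ := len_mul_simpleRefl_of_lt hv
    have h₂ := len_mul_simpleRefl_of_gt hw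
    omega
  · have h₁ := lower_bruhatLE i v
    have h₂ := bruhatLE_upper i (v * Equiv.swap a b)
    rw [lower, upper, lower, upper, if_pos hv, if_neg hw.not_gt] at *
    rw [if_pos hv, if_neg hw.not_gt]
    exact ⟨h₁.trans hle, hle.trans h₂⟩
  · have h₁ := len_mul_simpleRefl_of_gt hv
    have h₂ := len_mul_simpleRefl_of_gt hw
    rw [lower, lower, upper, upper, if_pos hv, if_pos hw, if_pos hv, if_pos hw]
    exact ⟨hcov (by omega), hle⟩

/-- The lifting property of the Bruhat order. -/
lemma BruhatLE.lower_upper {v w : Equiv.Perm (Fin n)} (h : BruhatLE n v w) (i : Fin (n - 1)) :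
    BruhatLE n (lower i v) (lower i w) ∧ BruhatLE n (upper i v) (upper i w) := by
  induction h with
  | refl => exact ⟨.refl, .refl⟩
  | tail _ hc ih => exact ⟨ih.1.trans (hc.lower_upper i).1, ih.2.trans (hc.lower_upper i).2⟩

lemma lower_bruhatLE_iff {v w : Equiv.Perm (Fin n)} {i : Fin (n - 1)}
    (h : len n w < len n (w * simpleRefl n i)) :
    BruhatLE n (lower i v) w ↔ BruhatLE n v (w * simpleRefl n i) := by
  have hw := lt_apply_of_len_lt h
  constructor <;> intro hle
  · have := (hle.lower_upper i).2
    rw [upper_lower] at this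
    have hu : upper i w = w * simpleRefl n i := if_neg hw.not_gt
    rw [← hu]
    exact (bruhatLE_upper i v).trans this
  · have := (hle.lower_upper i).1
    rwa [lower_mul_simpleRefl, show lower i w = w from if_neg hw.not_gt] at this

lemma BruhatLE.len_le {v w : Equiv.Perm (Fin n)} (h : BruhatLE n v w) : len n v ≤ len n w := by
  induction h with
  | refl => exact le_rfl
  | tail _ hc ih => obtain ⟨_, _, _, _, hl⟩ := hc; omega

lemma simpleRefl_lo_of_lt {i j : Fin (n - 1)} (h : (i : ℕ) < j) :
    simpleRefl n j (lo i) = lo i := by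
  apply simpleRefl_apply_of_ne <;> rw [Ne, Fin.ext_iff] <;> simp only [val_lo, val_hi] <;> omega

lemma simpleRefl_hi_of_lt {i j : Fin (n - 1)} (h : (i : ℕ) < j) :
    simpleRefl n i (hi j) = hi j := by
  apply simpleRefl_apply_of_ne <;> rw [Ne, Fin.ext_iff] <;> simp only [val_lo, val_hi] <;> omega

lemma simpleRefl_hi_of_add_one_lt {i j : Fin (n - 1)} (h : (i : ℕ) + 1 < j) :
    simpleRefl n j (hi i) = hi i := by
  apply simpleRefl_apply_of_ne <;> rw [Ne, Fin.ext_iff] <;> simp only [val_lo, val_hi] <;> omega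

lemma simpleRefl_lo_of_add_one_lt {i j : Fin (n - 1)} (h : (i : ℕ) + 1 < j) :
    simpleRefl n i (lo j) = lo j := by
  apply simpleRefl_apply_of_ne <;> rw [Ne, Fin.ext_iff] <;> simp only [val_lo, val_hi] <;> omega

lemma hi_eq_lo {i j : Fin (n - 1)} (h : (j : ℕ) = i + 1) : hi i = lo j :=
  Fin.ext (by rw [val_hi, val_lo, h])

lemma simpleRefl_comm {i j : Fin (n - 1)} (h : (i : ℕ) + 1 < j) :
    simpleRefl n i * simpleRefl n j = simpleRefl n j * simpleRefl n i := by
  have := simpleRefl_conj_swap i (lo j) (hi j)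
  rw [simpleRefl_lo_of_add_one_lt h, simpleRefl_hi_of_lt (by omega),
    ← simpleRefl_eq_swap] at this
  nth_rw 2 [← this]
  exact (mul_simpleRefl_cancel _ _).symm

lemma simpleRefl_braid {i j : Fin (n - 1)} (h : (j : ℕ) = i + 1) :
    simpleRefl n i * simpleRefl n j * simpleRefl n i =
      simpleRefl n j * simpleRefl n i * simpleRefl n j := by
  have e₁ := simpleRefl_conj_swap i (lo j) (hi j)
  have e₂ := simpleRefl_conj_swap j (lo i) (hi i)
  rw [← simpleRefl_eq_swap, ← hi_eq_lo h, simpleRefl_hi, simpleRefl_hi_of_lt (by omega)] at e₁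
  rw [← simpleRefl_eq_swap, hi_eq_lo h, simpleRefl_lo, simpleRefl_lo_of_lt (by omega)] at e₂
  rw [e₁, e₂]

lemma eq_one_of_forall_apply_lo_lt {w : Equiv.Perm (Fin n)} (h : ∀ i, w (lo i) < w (hi i)) :
    w = 1 := by
  cases n with
  | zero => exact Subsingleton.elim _ _
  | succ n =>
    have hmono : StrictMono w := Fin.strictMono_iff_lt_succ.2 fun i => h i
    have := Subsingleton.elim (hmono.orderIsoOfSurjective w w.surjective) (OrderIso.refl _)
    ext a
    exact congrArg Fin.val (DFunLike.congr_fun this a)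

lemma len_one : len n 1 = 0 := by
  rw [len, Finset.card_eq_zero, Finset.filter_eq_empty_iff]
  rintro p - ⟨h₁, h₂⟩
  exact h₁.not_gt h₂

lemma eq_one_of_len_eq_zero {w : Equiv.Perm (Fin n)} (h : len n w = 0) : w = 1 :=
  eq_one_of_forall_apply_lo_lt fun i => by
    rcases apply_lo_lt_or_gt w i with h' | h'
    · exact h'
    · have := len_mul_simpleRefl_of_gt h'; omega

lemma bruhatLE_one_iff {v : Equiv.Perm (Fin n)} : BruhatLE n v 1 ↔ v = 1 := by
  refine ⟨fun h => eq_one_of_len_eq_zero ?_, fun h => h ▸ .refl⟩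
  simpa [len_one] using h.len_le

lemma len_inv (w : Equiv.Perm (Fin n)) : len n w⁻¹ = len n w := by
  refine Finset.card_nbij' (fun p => (w⁻¹ p.2, w⁻¹ p.1)) (fun p => (w p.2, w p.1)) ?_ ?_ ?_ ?_ <;>
    simp +contextual [Set.MapsTo, Set.LeftInvOn]

lemma len_add_len_mul_revPerm (w : Equiv.Perm (Fin n)) :
    len n (w * Fin.revPerm) + len n w =
      ((Finset.univ : Finset (Fin n × Fin n)).filter fun p => p.1 < p.2).card := by
  have h : len n (w * Fin.revPerm) = ((Finset.univ : Finset (Fin n × Fin n)).filter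
      fun p => p.1 < p.2 ∧ ¬ w p.2 < w p.1).card := by
    refine Finset.card_nbij' (fun p => (p.2.rev, p.1.rev)) (fun p => (p.2.rev, p.1.rev))
      ?_ ?_ ?_ ?_
    · simp +contextual [Set.MapsTo, le_of_lt]
    · simp only [Set.MapsTo, Finset.coe_filter, Finset.mem_univ, true_and, Set.mem_ofPred_eq,
        Equiv.Perm.mul_apply, Fin.revPerm_apply, Fin.rev_rev, Fin.rev_lt_rev, not_lt]
      rintro ⟨a, b⟩ ⟨h₁, h₂⟩
      exact ⟨h₁, lt_of_le_of_ne h₂ (w.injective.ne h₁.ne)⟩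
    · simp [Set.LeftInvOn]
    · simp [Set.LeftInvOn]
  rw [h, len, add_comm, ← Finset.filter_filter, ← Finset.filter_filter,
    Finset.card_filter_add_card_filter_not]

lemma len_prod_map_simpleRefl_le (L : List (Fin (n - 1))) :
    len n (L.map (simpleRefl n)).prod ≤ L.length := by
  induction L using List.reverseRecOn with
  | nil => simp [len_one]
  | append_singleton L i ih =>
    have := len_mul_simpleRefl_le (L.map (simpleRefl n)).prod i
    simp only [List.map_append, List.map_cons, List.map_nil, List.prod_append,
      List.prod_singleton, List.length_append, List.length_singleton]
    omega

lemma IsReducedWord.concat {L : List (Fin (n - 1))} {w : Equiv.Perm (Fin n)} {i : Fin (n - 1)}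
    (hL : IsReducedWord n L (w * simpleRefl n i)) (h : w (hi i) < w (lo i)) :
    IsReducedWord n (L ++ [i]) w := by
  have := len_mul_simpleRefl_of_gt h
  refine ⟨?_, ?_⟩
  · simp [hL.1, mul_simpleRefl_cancel]
  · simp [hL.2, this]

lemma IsReducedWord.of_concat {L : List (Fin (n - 1))} {w : Equiv.Perm (Fin n)}
    {i : Fin (n - 1)} (hL : IsReducedWord n (L ++ [i]) w) :
    IsReducedWord n L (w * simpleRefl n i) ∧ w (hi i) < w (lo i) := by
  obtain ⟨h₁, h₂⟩ := hL
  have hp : (L.map (simpleRefl n)).prod = w * simpleRefl n i := by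
    rw [← h₁]; simp [mul_assoc, simpleRefl_mul_self]
  have h₃ := len_prod_map_simpleRefl_le L
  have h₄ := le_len_mul_simpleRefl w i
  rw [hp] at h₃
  simp only [List.length_append, List.length_singleton] at h₂
  exact ⟨⟨hp, by omega⟩, gt_apply_of_len_lt (by omega)⟩

lemma exists_isReducedWord (w : Equiv.Perm (Fin n)) : ∃ L, IsReducedWord n L w := by
  induction hk : len n w generalizing w with
  | zero => exact ⟨[], by simp [eq_one_of_len_eq_zero hk], by simp [hk]⟩
  | succ k ih =>
    obtain ⟨i, hi⟩ : ∃ i, w (hi i) < w (lo i) := by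
      by_contra! hcon
      have := eq_one_of_forall_apply_lo_lt fun i =>
        lt_of_le_of_ne (hcon i) (w.injective.ne (lo_lt_hi i).ne)
      rw [this, len_one] at hk
      omega
    have := len_mul_simpleRefl_of_gt hi
    obtain ⟨L, hL⟩ := ih (w * simpleRefl n i) (by omega)
    exact ⟨L ++ [i], hL.concat hi⟩

/-- Matsumoto's theorem for the symmetric group: operators satisfying the braid relations have
the same composition along any two reduced words of a permutation. -/
theorem IsReducedWord.foldr_eq {α : Type*} {p : Fin (n - 1) → α → α}
    (hcomm : ∀ i j : Fin (n - 1), (i : ℕ) + 1 < j → ∀ f, p i (p j f) = p j (p i f))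
    (hbraid : ∀ i j : Fin (n - 1), (j : ℕ) = i + 1 →
      ∀ f, p i (p j (p i f)) = p j (p i (p j f)))
    {w : Equiv.Perm (Fin n)} {L L' : List (Fin (n - 1))} (hL : IsReducedWord n L w)
    (hL' : IsReducedWord n L' w) (f : α) : L.foldr p f = L'.foldr p f := by
  induction hk : len n w using Nat.strong_induction_on generalizing w L L' f with
  | _ k ih =>
  have hlt : ∀ (i j : Fin (n - 1)) (L₁ L₂ : List (Fin (n - 1))), (i : ℕ) < j →
      IsReducedWord n (L₁ ++ [i]) w → IsReducedWord n (L₂ ++ [j]) w →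
      (L₁ ++ [i]).foldr p f = (L₂ ++ [j]).foldr p f := by
    intro i j L₁ L₂ hij h₁ h₂
    obtain ⟨h₁, hi₁⟩ := h₁.of_concat
    obtain ⟨h₂, hj₂⟩ := h₂.of_concat
    have hleni := len_mul_simpleRefl_of_gt hi₁
    have hlenj := len_mul_simpleRefl_of_gt hj₂
    have hlij := simpleRefl_lo_of_lt hij
    have hhji := simpleRefl_hi_of_lt hij
    rcases Nat.lt_or_ge (i + 1 : ℕ) j with hfar | hnear
    · have hhij := simpleRefl_hi_of_add_one_lt hfar
      have hlji := simpleRefl_lo_of_add_one_lt hfar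
      have hs := simpleRefl_comm hfar
      obtain ⟨U, hU⟩ := exists_isReducedWord (w * simpleRefl n i * simpleRefl n j)
      have hUi := hU.concat (by simpa [hlji, hhji] using hj₂)
      rw [mul_assoc, hs, ← mul_assoc] at hU
      have hUj := hU.concat (by simpa [hlij, hhij] using hi₁)
      have e₁ := ih _ (by omega) h₁ hUi (p i f) rfl
      have e₂ := ih _ (by omega) h₂ hUj (p j f) rfl
      simp only [List.foldr_append, List.foldr_cons, List.foldr_nil] at e₁ e₂ ⊢
      rw [e₁, e₂, hcomm i j hfar]
    · have hj : (j : ℕ) = i + 1 := by omega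
      have hji := hi_eq_lo hj
      have hi₁' := hi₁
      rw [hji] at hi₁'
      have hhij : simpleRefl n j (hi i) = hi j := by rw [hji, simpleRefl_lo]
      have hlji : simpleRefl n i (lo j) = lo i := by rw [← hji, simpleRefl_hi]
      have hs := simpleRefl_braid hj
      obtain ⟨U, hU⟩ := exists_isReducedWord
        (w * (simpleRefl n i * simpleRefl n j * simpleRefl n i))
      have hU' := hU
      rw [hs] at hU'
      simp only [← mul_assoc] at hU hU'
      have hUi := (hU.concat (by
        simpa [simpleRefl_lo, hhij, hhji, hlij, hji] using hj₂)).concat (by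
        simpa [hhji, hlji] using hj₂.trans hi₁')
      have hUj := (hU'.concat (by
        simpa [simpleRefl_hi, hlji, hlij, hhji] using hi₁')).concat (by
        simpa [hhij, hlij] using hj₂.trans hi₁')
      have e₁ := ih _ (by omega) h₁ hUi (p i f) rfl
      have e₂ := ih _ (by omega) h₂ hUj (p j f) rfl
      simp only [List.foldr_append, List.foldr_cons, List.foldr_nil] at e₁ e₂ ⊢
      rw [e₁, e₂, hbraid i j hj]
  rcases L.eq_nil_or_concat' with rfl | ⟨L₁, i, rfl⟩
  · have : L' = [] := List.length_eq_zero_iff.1 (by rw [hL'.2, ← hL.2, List.length_nil])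
    rw [this]
  rcases L'.eq_nil_or_concat' with rfl | ⟨L₂, j, rfl⟩
  · have := hL.2.trans hL'.2.symm
    simp at this
  rcases lt_trichotomy (i : ℕ) j with hij | hij | hij
  · exact hlt i j L₁ L₂ hij hL hL'
  · obtain rfl := Fin.ext hij
    have h := hL.of_concat
    have := len_mul_simpleRefl_of_gt h.2
    simp only [List.foldr_append, List.foldr_cons, List.foldr_nil]
    exact ih _ (by omega) h.1 hL'.of_concat.1 _ rfl
  · exact (hlt j i L₂ L₁ hij hL' hL).symm

lemma X_lo_sub_X_hi_ne_zero (i : Fin (n - 1)) :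
    (X (lo i) - X (hi i) : MvPolynomial (Fin n) ℤ) ≠ 0 :=
  sub_ne_zero.2 ((X_injective (R := ℤ)).ne (lo_lt_hi i).ne)

lemma rename_simpleRefl_rename_simpleRefl (i : Fin (n - 1)) (f : MvPolynomial (Fin n) ℤ) :
    rename (simpleRefl n i) (rename (simpleRefl n i) f) = f := by
  have h : simpleRefl n i ∘ simpleRefl n i = id := funext (simpleRefl_simpleRefl i)
  rw [rename_rename, h, rename_id_apply]

lemma rename_simpleRefl_comm {i j : Fin (n - 1)} (h : (i : ℕ) + 1 < j)
    (f : MvPolynomial (Fin n) ℤ) :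
    rename (simpleRefl n i) (rename (simpleRefl n j) f) =
      rename (simpleRefl n j) (rename (simpleRefl n i) f) := by
  rw [rename_rename, rename_rename, ← Equiv.Perm.coe_mul, ← Equiv.Perm.coe_mul,
    simpleRefl_comm h]

lemma rename_simpleRefl_braid {i j : Fin (n - 1)} (h : (j : ℕ) = i + 1)
    (f : MvPolynomial (Fin n) ℤ) :
    rename (simpleRefl n i) (rename (simpleRefl n j) (rename (simpleRefl n i) f)) =
      rename (simpleRefl n j) (rename (simpleRefl n i) (rename (simpleRefl n j) f)) := by
  simp only [rename_rename, ← Equiv.Perm.coe_mul, ← mul_assoc]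
  rw [simpleRefl_braid h]

section Operators

variable {D : Fin (n - 1) → MvPolynomial (Fin n) ℤ → MvPolynomial (Fin n) ℤ}

lemma IsDividedDifference.mul_apply (hD : IsDividedDifference n D) (i : Fin (n - 1))
    (f : MvPolynomial (Fin n) ℤ) :
    (X (lo i) - X (hi i)) * D i f = f - rename (simpleRefl n i) f :=
  hD i f

lemma piOp_eq (i : Fin (n - 1)) (f : MvPolynomial (Fin n) ℤ) :
    piOp n D i f = f + (1 - X (lo i)) * D i f := rfl

lemma IsDividedDifference.mul_piOp (hD : IsDividedDifference n D) (i : Fin (n - 1))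
    (f : MvPolynomial (Fin n) ℤ) :
    (X (lo i) - X (hi i)) * piOp n D i f =
      (1 - X (hi i)) * f - (1 - X (lo i)) * rename (simpleRefl n i) f := by
  rw [piOp_eq]
  linear_combination (1 - X (lo i)) * hD.mul_apply i f

lemma IsDividedDifference.rename_piOp (hD : IsDividedDifference n D) (i : Fin (n - 1))
    (f : MvPolynomial (Fin n) ℤ) :
    rename (simpleRefl n i) (piOp n D i f) = piOp n D i f := by
  have h₁ := hD.mul_piOp i f
  have h₂ := congrArg (rename (simpleRefl n i)) h₁
  simp only [map_mul, map_sub, map_one, rename_X, simpleRefl_lo, simpleRefl_hi,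
    rename_simpleRefl_rename_simpleRefl] at h₂
  apply mul_left_cancel₀ (X_lo_sub_X_hi_ne_zero i)
  linear_combination -h₁ - h₂

lemma IsDividedDifference.piOp_eq_self_iff (hD : IsDividedDifference n D) {i : Fin (n - 1)}
    {f : MvPolynomial (Fin n) ℤ} :
    piOp n D i f = f ↔ rename (simpleRefl n i) f = f := by
  refine ⟨fun h => h ▸ hD.rename_piOp i f, fun h => ?_⟩
  have h₁ := hD.mul_piOp i f
  rw [h] at h₁
  apply mul_left_cancel₀ (X_lo_sub_X_hi_ne_zero i)
  linear_combination h₁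

lemma IsDividedDifference.piOp_piOp_self (hD : IsDividedDifference n D) (i : Fin (n - 1))
    (f : MvPolynomial (Fin n) ℤ) : piOp n D i (piOp n D i f) = piOp n D i f :=
  hD.piOp_eq_self_iff.2 (hD.rename_piOp i f)

lemma IsDividedDifference.piOp_comm (hD : IsDividedDifference n D) {i j : Fin (n - 1)}
    (h : (i : ℕ) + 1 < j) (f : MvPolynomial (Fin n) ℤ) :
    piOp n D i (piOp n D j f) = piOp n D j (piOp n D i f) := by
  have e₁ := hD.mul_piOp i f
  have e₂ := hD.mul_piOp j f
  have e₃ := hD.mul_piOp i (piOp n D j f)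
  have e₄ := hD.mul_piOp j (piOp n D i f)
  have e₁' := congrArg (rename (simpleRefl n j)) e₁
  have e₂' := congrArg (rename (simpleRefl n i)) e₂
  simp only [map_mul, map_sub, map_one, rename_X, simpleRefl_lo_of_add_one_lt h,
    simpleRefl_hi_of_add_one_lt h, simpleRefl_lo_of_lt (show (i : ℕ) < j by omega),
    simpleRefl_hi_of_lt (show (i : ℕ) < j by omega), ← rename_simpleRefl_comm h] at e₁' e₂'
  apply mul_left_cancel₀ (mul_ne_zero (X_lo_sub_X_hi_ne_zero i) (X_lo_sub_X_hi_ne_zero j))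
  linear_combination (X (lo j) - X (hi j)) * e₃ + (1 - X (hi i)) * e₂ - (1 - X (lo i)) * e₂' -
    (X (lo i) - X (hi i)) * e₄ - (1 - X (hi j)) * e₁ + (1 - X (lo j)) * e₁'

lemma IsDividedDifference.piOp_braid (hD : IsDividedDifference n D) {i j : Fin (n - 1)}
    (h : (j : ℕ) = i + 1) (f : MvPolynomial (Fin n) ℤ) :
    piOp n D i (piOp n D j (piOp n D i f)) = piOp n D j (piOp n D i (piOp n D j f)) := by
  have hij : (i : ℕ) < j := by omega
  have hne : (X (lo i) - X (hi j) : MvPolynomial (Fin n) ℤ) ≠ 0 :=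
    sub_ne_zero.2 ((X_injective (R := ℤ)).ne ((lo_lt_hi i).trans (hi_eq_lo h ▸ lo_lt_hi j)).ne)
  have hi' := X_lo_sub_X_hi_ne_zero i
  have hj' := X_lo_sub_X_hi_ne_zero j
  have hs₁ : simpleRefl n i (lo j) = lo i := by rw [← hi_eq_lo h, simpleRefl_hi]
  have hs₂ := simpleRefl_hi_of_lt hij
  have hs₃ := simpleRefl_lo_of_lt hij
  have p₁ := hD.mul_piOp i f
  have p₂ := congrArg (rename (simpleRefl n j)) p₁
  have p₃ := congrArg (rename (simpleRefl n i)) p₂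
  have p₄ := hD.mul_piOp j (piOp n D i f)
  have p₅ := congrArg (rename (simpleRefl n i)) p₄
  have p₆ := hD.mul_piOp i (piOp n D j (piOp n D i f))
  have q₁ := hD.mul_piOp j f
  have q₂ := congrArg (rename (simpleRefl n i)) q₁
  have q₃ := congrArg (rename (simpleRefl n j)) q₂
  have q₄ := hD.mul_piOp i (piOp n D j f)
  have q₅ := congrArg (rename (simpleRefl n j)) q₄
  have q₆ := hD.mul_piOp j (piOp n D i (piOp n D j f))
  simp only [map_mul, map_sub, map_one, rename_X, hi_eq_lo h, simpleRefl_lo, hs₁, hs₂, hs₃,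
    simpleRefl_hi, hD.rename_piOp, rename_simpleRefl_braid h]
    at p₁ p₂ p₃ p₄ p₅ p₆ q₁ q₂ q₃ q₄ q₅ q₆ hi'
  apply mul_left_cancel₀ (mul_ne_zero (mul_ne_zero hi' hj') hne)
  linear_combination (X (lo j) - X (hi j)) * (X (lo i) - X (hi j)) * p₆ +
    (1 - X (lo j)) * (X (lo i) - X (hi j)) * p₄ - (1 - X (lo i)) * (X (lo j) - X (hi j)) * p₅ +
    (1 - X (hi j)) ^ 2 * p₁ - (1 - X (lo j)) ^ 2 * p₂ + (1 - X (lo i)) ^ 2 * p₃ -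
    (X (lo i) - X (lo j)) * (X (lo i) - X (hi j)) * q₆ -
    (1 - X (hi j)) * (X (lo i) - X (hi j)) * q₄ + (1 - X (lo j)) * (X (lo i) - X (lo j)) * q₅ -
    (1 - X (lo j)) * (1 - X (hi j)) * q₁ + (1 - X (hi j)) * (1 - X (lo i)) * q₂ -
    (1 - X (lo j)) * (1 - X (lo i)) * q₃

lemma IsDividedDifference.applyPis_eq (hD : IsDividedDifference n D) {w : Equiv.Perm (Fin n)}
    {L L' : List (Fin (n - 1))} (hL : IsReducedWord n L w) (hL' : IsReducedWord n L' w)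
    (f : MvPolynomial (Fin n) ℤ) : applyPis n D L f = applyPis n D L' f :=
  hL.foldr_eq (fun _ _ h => hD.piOp_comm h) (fun _ _ h => hD.piOp_braid h) hL' f

/-- The substitution `x_i ↦ t x_i`, used to measure the order of vanishing at the origin. -/
def homogenize (n : ℕ) :
    MvPolynomial (Fin n) ℤ →ₐ[ℤ] Polynomial (MvPolynomial (Fin n) ℤ) :=
  aeval fun i => Polynomial.X * Polynomial.C (X i)

lemma homogenize_X (a : Fin n) :
    homogenize n (X a) = Polynomial.X * Polynomial.C (X a) := aeval_X _ _

lemma homogenize_rename (s : Equiv.Perm (Fin n)) (f : MvPolynomial (Fin n) ℤ) :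
    homogenize n (rename s f) =
      Polynomial.mapRingHom (rename s : _ →ₐ[ℤ] MvPolynomial (Fin n) ℤ).toRingHom
        (homogenize n f) := by
  induction f using MvPolynomial.induction_on with
  | C c => simp [homogenize]
  | add p q hp hq => simp only [map_add, hp, hq]
  | mul_X p a hp =>
    rw [map_mul, map_mul, map_mul, map_mul, hp, rename_X, homogenize_X, homogenize_X]
    simp

lemma IsDividedDifference.pow_dvd_homogenize_piOp (hD : IsDividedDifference n D) {k : ℕ}
    (i : Fin (n - 1)) {f : MvPolynomial (Fin n) ℤ}
    (h : Polynomial.X ^ (k + 1) ∣ homogenize n f) :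
    Polynomial.X ^ k ∣ homogenize n (piOp n D i f) := by
  have h₁ : Polynomial.X ^ (k + 1) ∣ homogenize n (rename (simpleRefl n i) f) := by
    rw [homogenize_rename]
    simpa using map_dvd (Polynomial.mapRingHom
      (rename (simpleRefl n i) : _ →ₐ[ℤ] MvPolynomial (Fin n) ℤ).toRingHom) h
  have h₂ := congrArg (homogenize n) (hD.mul_apply i f)
  rw [map_mul, map_sub, map_sub, homogenize_X, homogenize_X, ← mul_sub, ← Polynomial.C_sub,
    mul_assoc] at h₂
  have h₃ := h₂ ▸ dvd_sub h h₁
  rw [pow_succ', mul_dvd_mul_iff_left Polynomial.X_ne_zero] at h₃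
  have h₄ : Polynomial.X ^ k ∣ homogenize n (D i f) :=
    Polynomial.prime_X.pow_dvd_of_dvd_mul_left k (by
      rw [Polynomial.X_dvd_iff, Polynomial.coeff_C_zero]
      exact X_lo_sub_X_hi_ne_zero i) h₃
  rw [piOp_eq, map_add, map_mul]
  exact dvd_add ((pow_dvd_pow _ k.le_succ).trans h) (h₄.mul_left _)

lemma IsDividedDifference.pow_dvd_homogenize_applyPis (hD : IsDividedDifference n D) {k : ℕ}
    (L : List (Fin (n - 1))) {f : MvPolynomial (Fin n) ℤ}
    (h : Polynomial.X ^ (k + L.length) ∣ homogenize n f) :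
    Polynomial.X ^ k ∣ homogenize n (applyPis n D L f) := by
  induction L generalizing k with
  | nil => exact h
  | cons i L ih =>
    refine hD.pow_dvd_homogenize_piOp i (ih ?_)
    rwa [List.length_cons, ← add_assoc, add_right_comm] at h

lemma card_filter_lt (n : ℕ) :
    ((Finset.univ : Finset (Fin n × Fin n)).filter fun p => p.1 < p.2).card =
      ∑ a : Fin n, (n - 1 - (a : ℕ)) := by
  rw [Finset.card_filter, Fintype.sum_prod_type]
  refine Finset.sum_congr rfl fun a _ => ?_
  rw [← Finset.card_filter, ← Fin.card_Ioi]
  congr 1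
  ext b
  simp

lemma pow_dvd_homogenize_Gw0 (n : ℕ) :
    Polynomial.X ^ (∑ a : Fin n, (n - 1 - (a : ℕ))) ∣ homogenize n (Gw0 n) := by
  rw [Gw0, map_prod, ← Finset.prod_pow_eq_pow_sum]
  refine Finset.prod_dvd_prod_of_dvd _ _ fun a _ => ?_
  rw [map_pow, homogenize_X, mul_pow]
  exact dvd_mul_right _ _

lemma degreeOf_X_sub_X {a b : Fin n} (h : a ≠ b) :
    degreeOf a (X a - X b : MvPolynomial (Fin n) ℤ) = 1 := by
  rw [sub_eq_add_neg, degreeOf_add_eq_of_degreeOf_lt, degreeOf_X_self]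
  rw [degreeOf_neg, degreeOf_X_of_ne h, degreeOf_X_self]
  exact one_pos

lemma degreeOf_rename_simpleRefl (i : Fin (n - 1)) (a : Fin n) (f : MvPolynomial (Fin n) ℤ) :
    degreeOf a (rename (simpleRefl n i) f) = degreeOf (simpleRefl n i a) f := by
  have := degreeOf_rename_of_injective (p := f) (simpleRefl n i).injective (simpleRefl n i a)
  rwa [simpleRefl_simpleRefl] at this

lemma IsDividedDifference.degreeOf_add_le (hD : IsDividedDifference n D) (i : Fin (n - 1))
    (a : Fin n) {f : MvPolynomial (Fin n) ℤ} (h : D i f ≠ 0) :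
    degreeOf a (X (lo i) - X (hi i) : MvPolynomial (Fin n) ℤ) + degreeOf a (D i f) ≤
      max (degreeOf a f) (degreeOf (simpleRefl n i a) f) := by
  rw [← degreeOf_mul_eq (X_lo_sub_X_hi_ne_zero i) h, hD.mul_apply, ← degreeOf_rename_simpleRefl]
  exact degreeOf_sub_le _ _ _

lemma degreeOf_one_sub_X_of_ne {a b : Fin n} (h : a ≠ b) :
    degreeOf a (1 - X b : MvPolynomial (Fin n) ℤ) = 0 := by
  have := degreeOf_sub_le a 1 (X b : MvPolynomial (Fin n) ℤ)
  rw [degreeOf_one, degreeOf_X_of_ne h] at this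
  omega

lemma degreeOf_one_sub_X_self_le (a : Fin n) :
    degreeOf a (1 - X a : MvPolynomial (Fin n) ℤ) ≤ 1 := by
  have := degreeOf_sub_le a 1 (X a : MvPolynomial (Fin n) ℤ)
  rwa [degreeOf_one, degreeOf_X_self] at this

lemma IsDividedDifference.degreeOf_piOp_le (hD : IsDividedDifference n D) (i : Fin (n - 1))
    {f : MvPolynomial (Fin n) ℤ} (h : ∀ a : Fin n, degreeOf a f ≤ n - 1 - a) (a : Fin n) :
    degreeOf a (piOp n D i f) ≤ n - 1 - a := by
  rw [piOp_eq]
  by_cases h₀ : D i f = 0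
  · simpa [h₀] using h a
  have hi := i.isLt
  have hlo := h (lo i)
  have hhi := h (_root_.hi i)
  rw [val_lo] at hlo
  rw [val_hi] at hhi
  have ha := h a
  have hle := hD.degreeOf_add_le i a h₀
  refine (MvPolynomial.degreeOf_add_le _ _ _).trans (max_le ha ?_)
  refine (degreeOf_mul_le _ _ _).trans ?_
  by_cases h₁ : a = lo i
  · subst h₁
    rw [degreeOf_X_sub_X (lo_lt_hi i).ne, simpleRefl_lo] at hle
    have := degreeOf_one_sub_X_self_le (lo i)
    rw [val_lo]
    omega
  · rw [degreeOf_one_sub_X_of_ne h₁]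
    by_cases h₂ : a = _root_.hi i
    · subst h₂
      rw [← neg_sub, degreeOf_neg, degreeOf_X_sub_X (lo_lt_hi i).ne', simpleRefl_hi] at hle
      rw [val_hi]
      omega
    · rw [simpleRefl_apply_of_ne h₁ h₂] at hle
      omega

lemma IsDividedDifference.degreeOf_applyPis_le (hD : IsDividedDifference n D)
    (L : List (Fin (n - 1))) {f : MvPolynomial (Fin n) ℤ}
    (h : ∀ a : Fin n, degreeOf a f ≤ n - 1 - a) (a : Fin n) :
    degreeOf a (applyPis n D L f) ≤ n - 1 - a := by
  induction L generalizing a with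
  | nil => exact h a
  | cons i L ih => exact hD.degreeOf_piOp_le i ih a

lemma degreeOf_Gw0_le (a : Fin n) : degreeOf a (Gw0 n) ≤ n - 1 - a := by
  refine (degreeOf_prod_le _ _ _).trans ?_
  rw [Finset.sum_eq_single_of_mem a (Finset.mem_univ a), degreeOf_X_self_pow]
  intro b _ hb
  exact degreeOf_X_pow_of_ne _ hb.symm

lemma eval_one_applyPis (L : List (Fin (n - 1))) (f : MvPolynomial (Fin n) ℤ) :
    eval (fun _ => 1) (applyPis n D L f) = eval (fun _ => 1) f := by
  induction L with
  | nil => rfl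
  | cons i L ih =>
    change eval _ (piOp n D i (applyPis n D L f)) = _
    simp [piOp_eq, ih]

/-- A polynomial invariant under all simple reflections which does not involve the last variable
is constant. -/
lemma eq_C_of_forall_rename_eq {f : MvPolynomial (Fin n) ℤ}
    (hf : ∀ i, rename (simpleRefl n i) f = f) (hdeg : ∀ a : Fin n, degreeOf a f ≤ n - 1 - a) :
    f = C (coeff 0 f) := by
  have h₀ : ∀ (k : ℕ) (a : Fin n), n - 1 - (a : ℕ) = k → degreeOf a f = 0 := by
    intro k
    induction k with
    | zero => intro a ha; simpa [ha] using hdeg a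
    | succ k ih =>
      intro a ha
      let i : Fin (n - 1) := ⟨a, by omega⟩
      have hai : a = lo i := rfl
      have := degreeOf_rename_simpleRefl i a f
      rw [hf, hai, simpleRefl_lo] at this
      rw [hai, this]
      refine ih _ ?_
      rw [val_hi]
      simp only [i]
      omega
  rw [← vars_eq_empty_iff_eq_C, Finset.eq_empty_iff_forall_notMem]
  intro a ha
  exact mem_vars_iff_degreeOf_ne_zero.1 ha (h₀ _ a rfl)

/-- `f` is the Grothendieck polynomial of `v`. -/
def IsGrothendieck (D : Fin (n - 1) → MvPolynomial (Fin n) ℤ → MvPolynomial (Fin n) ℤ)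
    (v : Equiv.Perm (Fin n)) (f : MvPolynomial (Fin n) ℤ) : Prop :=
  ∃ M, IsReducedWord n M (v⁻¹ * Fin.revPerm) ∧ f = applyPis n D M (Gw0 n)

lemma IsReducedWord.length_add_len {M : List (Fin (n - 1))} {v : Equiv.Perm (Fin n)}
    (hM : IsReducedWord n M (v⁻¹ * Fin.revPerm)) :
    M.length + len n v = ∑ a : Fin n, (n - 1 - (a : ℕ)) := by
  rw [hM.2, ← card_filter_lt, ← len_add_len_mul_revPerm v⁻¹, len_inv]

lemma IsGrothendieck.piOp_of_gt {v : Equiv.Perm (Fin n)} {i : Fin (n - 1)}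
    {f : MvPolynomial (Fin n) ℤ} (hf : IsGrothendieck D v f) (h : v (hi i) < v (lo i)) :
    IsGrothendieck D (v * simpleRefl n i) (piOp n D i f) := by
  obtain ⟨M, hM, rfl⟩ := hf
  refine ⟨i :: M, ⟨?_, ?_⟩, rfl⟩
  · rw [List.map_cons, List.prod_cons, hM.1, mul_inv_rev, simpleRefl_inv, mul_assoc]
  · have h₁ := hM.length_add_len
    have h₂ := len_add_len_mul_revPerm (v * simpleRefl n i)⁻¹
    have h₃ := len_mul_simpleRefl_of_gt h
    rw [len_inv, card_filter_lt] at h₂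
    rw [List.length_cons]
    omega

lemma IsDividedDifference.piOp_eq_self_of_isGrothendieck (hD : IsDividedDifference n D)
    {v : Equiv.Perm (Fin n)} {i : Fin (n - 1)} {f : MvPolynomial (Fin n) ℤ}
    (hf : IsGrothendieck D v f) (h : v (lo i) < v (hi i)) : piOp n D i f = f := by
  obtain ⟨M, hM⟩ := exists_isReducedWord ((v * simpleRefl n i)⁻¹ * Fin.revPerm)
  have hg : IsGrothendieck D (v * simpleRefl n i * simpleRefl n i) _ :=
    IsGrothendieck.piOp_of_gt ⟨M, hM, rfl⟩ (by simpa [simpleRefl_lo, simpleRefl_hi] using h)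
  rw [mul_simpleRefl_cancel] at hg
  obtain ⟨M₁, hM₁, rfl⟩ := hf
  obtain ⟨M₂, hM₂, h₂⟩ := hg
  rw [hD.applyPis_eq hM₁ hM₂, ← h₂, hD.piOp_piOp_self]

lemma IsDividedDifference.isGrothendieck_lower (hD : IsDividedDifference n D)
    {v : Equiv.Perm (Fin n)} {f : MvPolynomial (Fin n) ℤ} (hf : IsGrothendieck D v f)
    (i : Fin (n - 1)) : IsGrothendieck D (lower i v) (piOp n D i f) := by
  rcases apply_lo_lt_or_gt v i with h | h
  · rw [hD.piOp_eq_self_of_isGrothendieck hf h, lower, if_neg h.not_gt]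
    exact hf
  · rw [lower, if_pos h]
    exact hf.piOp_of_gt h

lemma IsDividedDifference.eq_one_of_isGrothendieck_one (hD : IsDividedDifference n D)
    {f : MvPolynomial (Fin n) ℤ} (hf : IsGrothendieck D 1 f) : f = 1 := by
  have hsymm : ∀ i, rename (simpleRefl n i) f = f := fun i =>
    hD.piOp_eq_self_iff.1 (hD.piOp_eq_self_of_isGrothendieck hf (by simpa using lo_lt_hi i))
  obtain ⟨M, -, rfl⟩ := hf
  have hC := eq_C_of_forall_rename_eq hsymm (hD.degreeOf_applyPis_le M degreeOf_Gw0_le)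
  have hev := eval_one_applyPis (D := D) M (Gw0 n)
  rw [hC, eval_C] at hev
  rw [hC, hev]
  simp [Gw0]

lemma IsDividedDifference.isGrothendieck_eq_one_iff (hD : IsDividedDifference n D)
    {v : Equiv.Perm (Fin n)} {f : MvPolynomial (Fin n) ℤ} (hf : IsGrothendieck D v f) :
    f = 1 ↔ v = 1 := by
  refine ⟨fun h => ?_, fun h => hD.eq_one_of_isGrothendieck_one (h ▸ hf)⟩
  obtain ⟨M, hM, rfl⟩ := hf
  have hdvd := hD.pow_dvd_homogenize_applyPis (k := len n v) M
    (by rw [add_comm, hM.length_add_len]; exact pow_dvd_homogenize_Gw0 n)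
  rw [h, map_one] at hdvd
  by_contra hv
  exact Polynomial.prime_X.not_dvd_one
    ((dvd_pow_self _ fun h₀ => hv (eq_one_of_len_eq_zero h₀)).trans hdvd)

theorem IsDividedDifference.applyPis_eq_one_iff (hD : IsDividedDifference n D)
    {v w : Equiv.Perm (Fin n)} {f : MvPolynomial (Fin n) ℤ} (hf : IsGrothendieck D v f)
    {L : List (Fin (n - 1))} (hL : IsReducedWord n L w) :
    applyPis n D L f = 1 ↔ BruhatLE n v w := by
  induction L using List.reverseRecOn generalizing v w f with
  | nil =>
    obtain rfl : 1 = w := by simpa using hL.1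
    rw [bruhatLE_one_iff]
    exact hD.isGrothendieck_eq_one_iff hf
  | append_singleton L i ih =>
    obtain ⟨hL', hgt⟩ := hL.of_concat
    have hlen := len_mul_simpleRefl_of_gt hgt
    have hL_eq : applyPis n D (L ++ [i]) f = applyPis n D L (piOp n D i f) := by
      simp [applyPis]
    rw [hL_eq, ih (hD.isGrothendieck_lower hf i) hL',
      lower_bruhatLE_iff (by rw [mul_simpleRefl_cancel]; omega), mul_simpleRefl_cancel]

end Operators

end SymmetricGroup

/-- Let `v, w ∈ S_n`. For any reduced word `L` of `w`, any reduced word `M` of `v⁻¹w₀`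
(so that `𝔊_v = π_M(𝔊_{w₀})` is the Grothendieck polynomial of `v`), and any family `D` of
divided difference operators: `π_{i_1}∘⋯∘π_{i_l}(𝔊_v) = 1` if and only if `v ≤ w` in the
Bruhat order. -/
theorem statement16 (n : ℕ) (hn : 1 ≤ n) (v w : Equiv.Perm (Fin n))
    (D : Fin (n - 1) → MvPolynomial (Fin n) ℤ → MvPolynomial (Fin n) ℤ)
    (hD : IsDividedDifference n D)
    (L : List (Fin (n - 1))) (hL : IsReducedWord n L w)
    (M : List (Fin (n - 1))) (hM : IsReducedWord n M (v⁻¹ * Fin.revPerm)) :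
    applyPis n D L (applyPis n D M (Gw0 n)) = 1 ↔ BruhatLE n v w :=
  hD.applyPis_eq_one_iff ⟨M, hM, rfl⟩ hL
end
end

section
/- Let n ≥ 1. The family of products { F_{p_1}^1 · F_{p_2}^2 · ⋯ · F_{p_{n−1}}^{n−1} : 0 ≤ p_i ≤ i for i = 1, …, n−1 }, viewed in R[x_1, …, x_{n−1}] via the canonical map ℤ[q_1, …, q_{n−1}] → R, is an R-basis of the R-submodule L_n^R of R[x_1, …, x_{n−1}] freely spanned by the monomials x_1^{i_1}·⋯·x_{n−1}^{i_{n−1}} with 0 ≤ i_j ≤ n−j for all j. -/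
open MvPolynomial Finset

noncomputable section

set_option maxHeartbeats 1000000

/-- The polynomial ring `ℤ[q_1, …, q_{n−1}]`; the variable `i : Fin (n−1)` is `q_{i+1}`. -/
abbrev QPoly (n : ℕ) := MvPolynomial (Fin (n - 1)) ℤ

/-- The multiplicative set generated by the elements `1 − q_i`. -/
def qSubmonoid (n : ℕ) : Submonoid (QPoly n) :=
  Submonoid.closure (Set.range fun i : Fin (n - 1) => 1 - MvPolynomial.X i)

/-- `R = ℤ[q_1, …, q_{n−1}][(1−q_1)⁻¹, …, (1−q_{n−1})⁻¹]`. -/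
abbrev QRing (n : ℕ) := Localization (qSubmonoid n)

/-- The polynomial ring `R[x_1, …, x_{n−1}]`; the variable `i : Fin (n−1)` is `x_{i+1}`. -/
abbrev PolyR (n : ℕ) := MvPolynomial (Fin (n - 1)) (QRing n)

/-- The image of `q_{i+1}` in `R[x_1, …, x_{n−1}]` under the canonical map. -/
def qC (n : ℕ) (i : Fin (n - 1)) : PolyR n :=
  C (algebraMap (QPoly n) (QRing n) (MvPolynomial.X i))

/-- The polynomial `F_p^k` viewed in `R[x_1, …, x_{n−1}]` (for `0 ≤ p ≤ k ≤ n−1`);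
the index `i : Fin (n−1)` corresponds to the `1`-based position `i+1 ∈ {1, …, k}`. -/
def FR (n : ℕ) (p k : ℕ) : PolyR n :=
  if p ≤ k then
    ∑ I ∈ ((Finset.univ : Finset (Fin (n - 1))).filter fun i : Fin (n - 1) => (i : ℕ) < k).powersetCard p,
      (∏ i ∈ I, (1 - X i)) *
        ∏ i ∈ I.filter (fun i : Fin (n - 1) => ¬ ∃ j ∈ I, (j : ℕ) = (i : ℕ) + 1), (1 - qC n i)
  else 0

/-- The `R`-submodule `L_n^R` of `R[x_1, …, x_{n−1}]` spanned by the monomials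
`x_1^{i_1}⋯x_{n−1}^{i_{n−1}}` with `0 ≤ i_j ≤ n−j`. -/
def Lmod (n : ℕ) : Submodule (QRing n) (PolyR n) :=
  Submodule.span (QRing n)
    {m : PolyR n | ∃ α : Fin (n - 1) → ℕ,
      (∀ i : Fin (n - 1), α i + ((i : ℕ) + 1) ≤ n) ∧ m = ∏ i : Fin (n - 1), X i ^ α i}

/-- The family of products `F_{p_1}^1·F_{p_2}^2·⋯·F_{p_{n−1}}^{n−1}` with `0 ≤ p_i ≤ i`. -/
def famF (n : ℕ) (p : (i : Fin (n - 1)) → Fin ((i : ℕ) + 2)) : PolyR n :=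
  ∏ i : Fin (n - 1), FR n (p i) ((i : ℕ) + 1)

/-- The Laurent polynomials all of whose exponents `x` satisfy `0 ≤ x i` for `i ∈ T` and
`x i ≤ e i` for `i ∈ U`. -/
def laurentBox (R : Type*) [CommRing R] {ι : Type*} (T U : Set ι) (e : ι → ℤ) :
    Submodule R (AddMonoidAlgebra R (ι → ℤ)) where
  carrier := {f | ∀ x, f.coeff x ≠ 0 → (∀ i ∈ T, 0 ≤ x i) ∧ ∀ i ∈ U, x i ≤ e i}
  zero_mem' := fun x hx => absurd rfl hx
  add_mem' := fun {f g} hf hg x hx => by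
    by_cases h : f.coeff x = 0
    · exact hg x fun h' => hx (by simp [h, h'])
    · exact hf x h
  smul_mem' := fun r f hf x hx => hf x fun h => hx (by simp [h])

section LaurentBox

variable {R : Type*} [CommRing R] {ι : Type*} {T U T' U' : Set ι} {e e' : ι → ℤ}
  {f g : AddMonoidAlgebra R (ι → ℤ)}

lemma laurentBox_mono (hT : T' ⊆ T) (hU : U' ⊆ U) (he : ∀ i ∈ U', e i ≤ e' i)
    (hf : f ∈ laurentBox R T U e) : f ∈ laurentBox R T' U' e' := fun x hx =>
  ⟨fun i hi => (hf x hx).1 i (hT hi), fun i hi => ((hf x hx).2 i (hU hi)).trans (he i hi)⟩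

lemma single_mem_laurentBox {x : ι → ℤ} (hT : ∀ i ∈ T, 0 ≤ x i) (hU : ∀ i ∈ U, x i ≤ e i)
    (r : R) : AddMonoidAlgebra.single x r ∈ laurentBox R T U e := fun y hy => by
  classical
  obtain rfl : x = y := by
    by_contra h
    exact hy (by simp [h])
  exact ⟨hT, hU⟩

lemma mul_mem_laurentBox (hf : f ∈ laurentBox R T U e) (hg : g ∈ laurentBox R T U e') :
    f * g ∈ laurentBox R T U (e + e') := fun x hx => by
  classical
  obtain ⟨a, ha, b, hb, rfl⟩ := Finset.mem_add.1
    (AddMonoidAlgebra.support_coeff_mul_subset f g (Finsupp.mem_support_iff.2 hx))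
  have ha := hf a (Finsupp.mem_support_iff.1 ha)
  have hb := hg b (Finsupp.mem_support_iff.1 hb)
  exact ⟨fun i hi => add_nonneg (ha.1 i hi) (hb.1 i hi),
    fun i hi => add_le_add (ha.2 i hi) (hb.2 i hi)⟩

lemma mulVec_mem_laurentBox {σ : Type*} [Fintype σ]
    {d : Matrix σ σ (AddMonoidAlgebra R (ι → ℤ))} {v : σ → AddMonoidAlgebra R (ι → ℤ)}
    (hd : ∀ s t, d s t ∈ laurentBox R T U e) (hv : ∀ s, v s ∈ laurentBox R T U e') (s : σ) :
    d.mulVec v s ∈ laurentBox R T U (e + e') :=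
  Submodule.sum_mem _ fun t _ => mul_mem_laurentBox (hd s t) (hv t)

lemma exists_add_of_mem_laurentBox_diff (j : ι)
    (hf : f ∈ laurentBox R (T \ {j}) (U \ {j}) e) (he : -1 ≤ e j) :
    ∃ a ∈ laurentBox R T (U \ {j}) e, ∃ b ∈ laurentBox R (T \ {j}) U e, f = a + b := by
  classical
  refine ⟨.ofCoeff (f.coeff.filter fun x => 0 ≤ x j), fun x hx => ?_,
    .ofCoeff (f.coeff.filter fun x => ¬ 0 ≤ x j), fun x hx => ?_, ?_⟩
  · have h := Finsupp.mem_support_iff.2 hx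
    obtain ⟨h1, h2⟩ : f.coeff x ≠ 0 ∧ _ := by simpa [Finsupp.support_filter] using h
    refine ⟨fun i hi => ?_, (hf x h1).2⟩
    by_cases hij : i = j
    · exact hij ▸ h2
    · exact (hf x h1).1 i ⟨hi, hij⟩
  · have h := Finsupp.mem_support_iff.2 hx
    obtain ⟨h1, h2⟩ : f.coeff x ≠ 0 ∧ _ := by simpa [Finsupp.support_filter] using h
    refine ⟨(hf x h1).1, fun i hi => ?_⟩
    by_cases hij : i = j
    · subst hij; omega
    · exact (hf x h1).2 i ⟨hi, hij⟩
  · rw [← AddMonoidAlgebra.ofCoeff_add, Finsupp.filter_add_filter_not]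

/-- A Čech-style induction over the coordinates in `T ∩ U`: a locally contractible differential
whose entries have degree at most one in each variable is exact in high enough multidegrees. -/
theorem exists_mulVec_eq_of_mulVec_eq_zero {k : ℕ} {σ : Type*} [Fintype σ] [DecidableEq σ]
    {d : Matrix σ σ (AddMonoidAlgebra R (Fin k → ℤ))} (hd : d * d = 0)
    (hdeg : ∀ s t, d s t ∈ laurentBox R Set.univ Set.univ 1)
    (hloc : ∀ U : Set (Fin k), ∃ h : Matrix σ σ (AddMonoidAlgebra R (Fin k → ℤ)),
      (∀ s t, h s t ∈ laurentBox R Uᶜ U (-1)) ∧ d * h + h * d = 1)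
    (j : ℕ) (T U : Set (Fin k)) (e : Fin k → ℤ) (hTU : ∀ i ∈ T, i ∈ U → (i : ℕ) < j)
    (he : ∀ i : Fin k, (i : ℕ) < j → (j : ℤ) - i ≤ e i)
    (v : σ → AddMonoidAlgebra R (Fin k → ℤ)) (hv : ∀ s, v s ∈ laurentBox R T U e)
    (hdv : d.mulVec v = 0) : ∃ w, (∀ s, w s ∈ laurentBox R T U (e - 1)) ∧ d.mulVec w = v := by
  induction j generalizing T U e v with
  | zero =>
    obtain ⟨h, hh, hdh⟩ := hloc U
    refine ⟨h.mulVec v, fun s => ?_, ?_⟩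
    · have hT : T ⊆ Uᶜ := fun i hi hi' => absurd (hTU i hi hi') (by simp)
      rw [sub_eq_neg_add]
      exact mulVec_mem_laurentBox
        (fun s t => laurentBox_mono hT subset_rfl (fun _ _ => le_rfl) (hh s t)) hv s
    · have := congrArg (fun m => m.mulVec v) hdh
      simpa [Matrix.add_mulVec, ← Matrix.mulVec_mulVec, hdv] using this
  | succ j ih =>
    by_cases hj : ∃ i₀ : Fin k, (i₀ : ℕ) = j ∧ i₀ ∈ T ∧ i₀ ∈ U
    swap
    · refine ih T U e (fun i hi hi' => ?_) (fun i hi => ?_) v hv hdv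
      · have := hTU i hi hi'
        have : (i : ℕ) ≠ j := fun h => hj ⟨i, h, hi, hi'⟩
        omega
      · have := he i (by omega)
        push_cast at this
        omega
    obtain ⟨i₀, hi₀, hT, hU⟩ := hj
    have hlt : ∀ i : Fin k, (i : ℕ) < j + 1 → i ≠ i₀ → (i : ℕ) < j := fun i hi hne => by
      have : (i : ℕ) ≠ j := fun h => hne (Fin.ext (h.trans hi₀.symm))
      omega
    have hdeg' : ∀ (T U : Set (Fin k)) s t, d s t ∈ laurentBox R T U 1 := fun T U s t =>
      laurentBox_mono (Set.subset_univ _) (Set.subset_univ _) (fun _ _ => le_rfl) (hdeg s t)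
    have heq : ∀ e : Fin k → ℤ, 1 + (e - 1) = e := fun e => by abel
    have he₀ := he i₀ (by omega)
    obtain ⟨a, ha, hda⟩ := ih T (U \ {i₀}) e
      (fun i hi hi' => hlt i (hTU i hi hi'.1) hi'.2)
      (fun i hi => by have := he i (by omega); push_cast at this; omega) v
      (fun s => laurentBox_mono subset_rfl Set.sdiff_subset (fun _ _ => le_rfl) (hv s)) hdv
    obtain ⟨b, hb, hdb⟩ := ih (T \ {i₀}) U e
      (fun i hi hi' => hlt i (hTU i hi.1 hi') hi.2)
      (fun i hi => by have := he i (by omega); push_cast at this; omega) v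
      (fun s => laurentBox_mono Set.sdiff_subset subset_rfl (fun _ _ => le_rfl) (hv s)) hdv
    obtain ⟨c, hc, hdc⟩ := ih (T \ {i₀}) (U \ {i₀}) (e - 1)
      (fun i hi hi' => hlt i (hTU i hi.1 hi'.1) hi.2)
      (fun i hi => by
        have := he i (by omega)
        push_cast at this
        simp only [Pi.sub_apply, Pi.one_apply]
        omega) (a - b)
      (fun s => Submodule.sub_mem _
        (laurentBox_mono Set.sdiff_subset subset_rfl (fun _ _ => le_rfl) (ha s))
        (laurentBox_mono subset_rfl Set.sdiff_subset (fun _ _ => le_rfl) (hb s)))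
      (by rw [Matrix.mulVec_sub, hda, hdb, sub_self])
    choose c₁ hc₁ c₂ hc₂ hcc using fun s => exists_add_of_mem_laurentBox_diff i₀ (hc s)
      (by simp only [Pi.sub_apply, Pi.one_apply]; push_cast at he₀; omega)
    obtain rfl : c = c₁ + c₂ := funext hcc
    have hglue : a - d.mulVec c₁ = b + d.mulVec c₂ := by
      rw [Matrix.mulVec_add] at hdc
      rw [sub_eq_iff_eq_add, add_assoc, add_comm (d.mulVec c₂), hdc]
      abel
    refine ⟨a - d.mulVec c₁, fun s x hx => ?_, ?_⟩
    · have h₁ : (a - d.mulVec c₁) s ∈ laurentBox R T (U \ {i₀}) (e - 1) :=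
        Submodule.sub_mem _ (ha s) (heq (e - 1) ▸ mulVec_mem_laurentBox (hdeg' _ _) hc₁ s)
      have h₂ : (a - d.mulVec c₁) s ∈ laurentBox R (T \ {i₀}) U (e - 1) := by
        rw [hglue]
        exact Submodule.add_mem _ (hb s) (heq (e - 1) ▸ mulVec_mem_laurentBox (hdeg' _ _) hc₂ s)
      exact ⟨(h₁ x hx).1, (h₂ x hx).2⟩
    · rw [Matrix.mulVec_sub, Matrix.mulVec_mulVec, hd, hda, Matrix.zero_mulVec, sub_zero]

end LaurentBox

/-- A matrix model of the Koszul complex on `N` elements: `D f` is contraction with `f`, `H c` is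
multiplication by `c`, and `s₀` indexes the degree zero part. -/
theorem exists_koszul_matrices (B : Type*) [CommRing B] (N : ℕ) :
    ∃ (σ : Type) (_ : Fintype σ) (_ : DecidableEq σ) (D H : (Fin N → B) → Matrix σ σ B) (s₀ : σ),
      (∀ f, D f * D f = 0) ∧ (∀ f c, D f * H c + H c * D f = (∑ p, c p * f p) • 1) ∧
      (∀ f s, D f s s₀ = 0) ∧ (∀ f s t, D f s t ∈ AddSubgroup.closure (Set.range f)) ∧
      ∀ c s t, H c s t ∈ AddSubgroup.closure (Set.range c) := by
  induction N with
  | zero =>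
    exact ⟨Unit, inferInstance, inferInstance, 0, 0, (), by simp, by simp, by simp,
      fun f s t => zero_mem _, fun f s t => zero_mem _⟩
  | succ N ih =>
    obtain ⟨σ, _, _, D, H, s₀, hD, hDH, hs, hDm, hHm⟩ := ih
    have hsub : ∀ f : Fin (N + 1) → B, AddSubgroup.closure (Set.range (Fin.tail f)) ≤
        AddSubgroup.closure (Set.range f) := fun f =>
      AddSubgroup.closure_mono (by rintro _ ⟨i, rfl⟩; exact ⟨i.succ, rfl⟩)
    have hscalar : ∀ (f : Fin (N + 1) → B) (s t : σ), (f 0 • (1 : Matrix σ σ B)) s t ∈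
        AddSubgroup.closure (Set.range f) := fun f s t => by
      by_cases h : s = t
      · subst h
        simpa using AddSubgroup.subset_closure (Set.mem_range_self 0)
      · simp [Matrix.one_apply_ne h, zero_mem]
    refine ⟨σ ⊕ σ, inferInstance, inferInstance,
      fun f => Matrix.fromBlocks (D (Fin.tail f)) (f 0 • 1) 0 (-D (Fin.tail f)),
      fun c => Matrix.fromBlocks (H (Fin.tail c)) 0 (c 0 • 1) (-H (Fin.tail c)), .inl s₀,
      fun f => ?_, fun f c => ?_, ?_, ?_, ?_⟩
    · simp [Matrix.fromBlocks_multiply, hD]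
    · rw [Matrix.fromBlocks_multiply, Matrix.fromBlocks_multiply, Matrix.fromBlocks_add,
        ← Matrix.fromBlocks_one, Matrix.fromBlocks_smul, Fin.sum_univ_succ]
      congr 1
      · have := hDH (Fin.tail f) (Fin.tail c)
        simp only [Fin.tail] at this ⊢
        simp only [add_smul, ← this, Matrix.zero_mul, add_zero, smul_mul_smul_comm, mul_one]
        rw [mul_comm (f 0)]
        abel
      · simp
      · simp
      · have := hDH (Fin.tail f) (Fin.tail c)
        simp only [Fin.tail] at this ⊢
        simp only [add_smul, ← this, Matrix.zero_mul, zero_add, smul_mul_smul_comm, mul_one,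
          neg_mul_neg]
        abel
    · rintro f (s | s) <;> simp [hs]
    · rintro f (s | s) (t | t)
      · exact hsub f (hDm _ s t)
      · exact hscalar f s t
      · exact zero_mem _
      · exact neg_mem (hsub f (hDm _ s t))
    · rintro f (s | s) (t | t)
      · exact hsub f (hHm _ s t)
      · exact zero_mem _
      · exact hscalar f s t
      · exact neg_mem (hsub f (hHm _ s t))

/-- The multihomogeneous forms `∑_{|I| = p} c_I ∏_{i ∈ I} v_i ∏_{i ∉ I} u_i` have no common zero
as soon as the coefficients `c_I` are units. -/
theorem span_range_multilinear_eq_top {B : Type*} [CommRing B] {k : ℕ} {u v : Fin k → B}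
    (huv : ∀ i, u i = 1 ∨ v i = 1) {c : Finset (Fin k) → B} (hc : ∀ I, IsUnit (c I)) :
    Ideal.span (Set.range fun p : Fin (k + 1) => ∑ I ∈ powersetCard (p : ℕ) univ,
      c I * ((∏ i ∈ I, v i) * ∏ i ∈ Iᶜ, u i)) = ⊤ := by
  classical
  by_contra hne
  obtain ⟨m, hm, hle⟩ := Ideal.exists_le_maximal _ hne
  have hp := hm.isPrime
  set S : Finset (Fin k) := univ.filter fun i => u i ∈ m with hS
  have hcard : #S < k + 1 := by
    have := card_le_univ S
    rw [Fintype.card_fin] at this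
    omega
  have hmem := hle (Ideal.subset_span ⟨⟨#S, hcard⟩, rfl⟩)
  have hSmem : S ∈ powersetCard #S univ := mem_powersetCard.2 ⟨subset_univ _, rfl⟩
  dsimp only at hmem
  rw [← add_sum_erase _ _ hSmem] at hmem
  have hrest : ∑ I ∈ (powersetCard #S univ).erase S,
      c I * ((∏ i ∈ I, v i) * ∏ i ∈ Iᶜ, u i) ∈ m := by
    refine Ideal.sum_mem _ fun I hI => ?_
    obtain ⟨hIS, hI⟩ := mem_erase.1 hI
    obtain ⟨i, hi, hiI⟩ : ∃ i ∈ S, i ∉ I := by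
      by_contra! h
      exact hIS (eq_of_subset_of_card_le h (mem_powersetCard.1 hI).2.le).symm
    refine Ideal.mul_mem_left _ _ (Ideal.mul_mem_left _ _ ?_)
    exact Ideal.mem_of_dvd _ (dvd_prod_of_mem u (mem_compl.2 hiI)) (mem_filter.1 hi).2
  have hmem := (Ideal.add_mem_iff_left _ hrest).1 hmem
  rcases hp.mem_or_mem hmem with h | h
  · exact hp.ne_top (Ideal.eq_top_of_isUnit_mem _ h (hc S))
  rcases hp.mem_or_mem h with h | h
  · obtain ⟨i, hi, h⟩ := hp.prod_mem_iff.1 h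
    rcases huv i with h' | h'
    · exact hp.ne_top ((Ideal.eq_top_iff_one _).2 (h' ▸ (mem_filter.1 hi).2))
    · exact hp.ne_top ((Ideal.eq_top_iff_one _).2 (h' ▸ h))
  · obtain ⟨i, hi, h⟩ := hp.prod_mem_iff.1 h
    exact mem_compl.1 hi (mem_filter.2 ⟨mem_univ _, h⟩)

section Multilinear

variable {R : Type*} [CommRing R] {k : ℕ}

/-- The Laurent monomial `∏ᵢ yᵢ ^ xᵢ`. -/
abbrev laurentMonomial (R : Type*) [CommRing R] {k : ℕ} (x : Fin k → ℤ) :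
    AddMonoidAlgebra R (Fin k → ℤ) :=
  AddMonoidAlgebra.single x 1

lemma laurentMonomial_mul (x y : Fin k → ℤ) :
    laurentMonomial R x * laurentMonomial R y = laurentMonomial R (x + y) := by
  simp [laurentMonomial, AddMonoidAlgebra.single_mul_single]

lemma laurentMonomial_prod {ι : Type*} (s : Finset ι) (x : ι → Fin k → ℤ) :
    ∏ i ∈ s, laurentMonomial R (x i) = laurentMonomial R (∑ i ∈ s, x i) := by
  simp [laurentMonomial, AddMonoidAlgebra.prod_single]

/-- The polynomial `∑_{|I| = p} c_I ∏_{i ∈ I} y_i`. -/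
def weightedEsymm {A : Type*} [CommRing A] [Algebra R A] (c : Finset (Fin k) → R) (y : Fin k → A)
    (p : ℕ) : A :=
  ∑ I ∈ powersetCard p univ, c I • ∏ i ∈ I, y i

lemma weightedEsymm_mem_laurentBox (c : Finset (Fin k) → R) (p : ℕ) :
    weightedEsymm c (fun i => laurentMonomial R (Pi.single i 1)) p ∈
      laurentBox R Set.univ Set.univ 1 := by
  classical
  refine Submodule.sum_mem _ fun I _ => Submodule.smul_mem _ _ ?_
  rw [laurentMonomial_prod]
  have h : ∀ i, (∑ j ∈ I, Pi.single (M := fun _ => ℤ) j 1) i = if i ∈ I then 1 else 0 := fun i => by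
    simp [Finset.sum_apply, Pi.single_apply]
  refine single_mem_laurentBox (fun i _ => ?_) (fun i _ => ?_) 1 <;> rw [h] <;> split_ifs <;> simp

lemma aeval_mem_laurentBox (U : Set (Fin k)) {z : Fin k → AddMonoidAlgebra R (Fin k → ℤ)}
    (hz : ∀ i, z i ∈ laurentBox R Uᶜ U 0) (f : MvPolynomial (Fin k) R) :
    aeval z f ∈ laurentBox R Uᶜ U 0 := by
  induction f using MvPolynomial.induction_on with
  | C a =>
    rw [aeval_C, AddMonoidAlgebra.coe_algebraMap]
    exact single_mem_laurentBox (fun _ _ => le_rfl) (fun _ _ => le_rfl) _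
  | add f g hf hg => rw [map_add]; exact Submodule.add_mem _ hf hg
  | mul_X f i hf =>
    rw [map_mul, aeval_X]
    simpa using mul_mem_laurentBox hf (hz i)

lemma exists_sum_mul_weightedEsymm_eq_one {c : Finset (Fin k) → R} (hc : ∀ I, IsUnit (c I))
    (U : Set (Fin k)) : ∃ b : Fin (k + 1) → AddMonoidAlgebra R (Fin k → ℤ),
      (∀ p, b p ∈ laurentBox R Uᶜ U (-1)) ∧
      ∑ p, b p * weightedEsymm c (fun i => laurentMonomial R (Pi.single i 1)) p = 1 := by
  classical
  have huv : ∀ i, (if i ∈ U then X i else 1 : MvPolynomial (Fin k) R) = 1 ∨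
      (if i ∈ U then 1 else X i : MvPolynomial (Fin k) R) = 1 := fun i => by
    by_cases h : i ∈ U <;> simp [h]
  have htop := span_range_multilinear_eq_top huv
    (fun I => (hc I).map (C : R →+* MvPolynomial (Fin k) R))
  rw [Ideal.eq_top_iff_one, Ideal.mem_span_range_iff_exists_fun] at htop
  obtain ⟨b, hb⟩ := htop
  set z : Fin k → AddMonoidAlgebra R (Fin k → ℤ) := fun i =>
    laurentMonomial R (Pi.single i (if i ∈ U then -1 else 1)) with hz
  have hzmem : ∀ i, z i ∈ laurentBox R Uᶜ U 0 := fun i => by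
    refine single_mem_laurentBox (fun l hl => ?_) (fun l hl => ?_) 1 <;>
    by_cases h : l = i
    · subst h; simp [show l ∉ U from hl]
    · simp [h]
    · subst h; simp [hl]
    · simp [h]
  set s : Fin k → AddMonoidAlgebra R (Fin k → ℤ) := fun i =>
    if i ∈ U then laurentMonomial R (Pi.single i (-1)) else 1 with hs
  have hsmem : ∏ i, s i ∈ laurentBox R Uᶜ U (-1) := by
    have : ∏ i, s i = laurentMonomial R (∑ i, if i ∈ U then Pi.single i (-1) else 0) := by
      rw [← laurentMonomial_prod]
      refine prod_congr rfl fun i _ => ?_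
      by_cases h : i ∈ U <;> simp [hs, h, AddMonoidAlgebra.one_def]
    rw [this]
    have h : ∀ i, (∑ j, if j ∈ U then Pi.single (M := fun _ => ℤ) j (-1) else 0) i =
        if i ∈ U then -1 else 0 := fun i => by
      rw [Finset.sum_apply, sum_eq_single i]
      · by_cases h : i ∈ U <;> simp [h]
      · intro j _ hj
        by_cases h : j ∈ U <;> simp [h, hj.symm]
      · simp
    refine single_mem_laurentBox (fun i hi => ?_) (fun i hi => ?_) 1 <;> rw [h]
    · simp [show i ∉ U from hi]
    · simp [hi]
  refine ⟨fun p => aeval z (b p) * ∏ i, s i, fun p => ?_, ?_⟩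
  · simpa using mul_mem_laurentBox (aeval_mem_laurentBox U hzmem (b p)) hsmem
  · have := congrArg (aeval z) hb
    rw [map_sum, map_one] at this
    rw [← this]
    refine sum_congr rfl fun p _ => ?_
    rw [map_mul, mul_assoc, map_sum, weightedEsymm, mul_sum]
    congr 1
    refine sum_congr rfl fun I _ => ?_
    rw [map_mul, map_mul, map_prod, map_prod, aeval_C, Algebra.smul_def, mul_left_comm,
      ← prod_mul_prod_compl I s, mul_right_comm, ← prod_mul_distrib]
    congr 2
    · refine prod_congr rfl fun i _ => ?_
      by_cases h : i ∈ U
      · simp only [hs, if_pos h, map_one, laurentMonomial_mul, ← Pi.single_add]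
        simp [laurentMonomial, AddMonoidAlgebra.one_def]
      · simp [hs, hz, h]
    · refine prod_congr rfl fun i _ => ?_
      by_cases h : i ∈ U <;> simp [hs, hz, h]

lemma laurentMonomial_mem_laurentBox_mul_span {c : Finset (Fin k) → R} (hc : ∀ I, IsUnit (c I))
    {a : Fin k → ℤ} (ha₀ : ∀ i, 0 ≤ a i) (ha : ∀ i : Fin k, a i + i ≤ k) :
    laurentMonomial R a ∈ laurentBox R Set.univ Set.univ (fun i : Fin k => (k : ℤ) - i - 1) *
      Submodule.span R (Set.range fun p : Fin (k + 1) =>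
        weightedEsymm c (fun i => laurentMonomial R (Pi.single i 1)) p) := by
  obtain ⟨σ, _, _, D, H, s₀, hD, hDH, hs, hDm, hHm⟩ :=
    exists_koszul_matrices (AddMonoidAlgebra R (Fin k → ℤ)) (k + 1)
  set f : Fin (k + 1) → AddMonoidAlgebra R (Fin k → ℤ) := fun p =>
    weightedEsymm c (fun i => laurentMonomial R (Pi.single i 1)) p with hf
  have hclosure : ∀ {b : Fin (k + 1) → AddMonoidAlgebra R (Fin k → ℤ)}
      {M : Submodule R (AddMonoidAlgebra R (Fin k → ℤ))} (_ : ∀ p, b p ∈ M)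
      {x : AddMonoidAlgebra R (Fin k → ℤ)}, x ∈ AddSubgroup.closure (Set.range b) → x ∈ M :=
    fun {b M} hb x hx => (AddSubgroup.closure_le M.toAddSubgroup).2
      (by rintro _ ⟨p, rfl⟩; exact hb p) hx
  obtain ⟨w, hw, hdw⟩ := exists_mulVec_eq_of_mulVec_eq_zero (hD f)
    (fun s t => hclosure (fun p => weightedEsymm_mem_laurentBox c p) (hDm f s t))
    (fun U => by
      obtain ⟨b, hb, hbf⟩ := exists_sum_mul_weightedEsymm_eq_one hc U
      refine ⟨H b, fun s t => hclosure hb (hHm b s t), ?_⟩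
      rw [hDH, hbf, one_smul])
    k Set.univ Set.univ (fun i : Fin k => (k : ℤ) - i) (fun i _ _ => i.2) (fun i _ => le_rfl)
    (Pi.single s₀ (laurentMonomial R a))
    (fun s => by
      by_cases h : s = s₀
      · subst h
        rw [Pi.single_eq_same]
        exact single_mem_laurentBox (fun i _ => ha₀ i) (fun i _ => by linarith [ha i]) 1
      · rw [Pi.single_eq_of_ne h]
        exact zero_mem _)
    (by
      ext1 s
      simp [hs])
  have h := congrFun hdw s₀
  rw [Pi.single_eq_same] at h
  rw [← h]
  refine Submodule.sum_mem _ fun t _ => ?_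
  change D f s₀ t * w t ∈ _
  rw [mul_comm (D f s₀ t)]
  exact Submodule.mul_mem_mul (hw t)
    (hclosure (fun p => Submodule.subset_span (Set.mem_range_self p)) (hDm f s₀ t))

lemma laurentBox_univ_le_span (e : Fin k → ℤ) : laurentBox R Set.univ Set.univ e ≤
    Submodule.span R {m | ∃ x : Fin k → ℤ, (∀ i, 0 ≤ x i ∧ x i ≤ e i) ∧ m = laurentMonomial R x} := by
  intro f hf
  rw [← AddMonoidAlgebra.sum_coeff_single f]
  refine Submodule.sum_mem _ fun x hx => ?_
  have h := hf x (Finsupp.mem_support_iff.1 hx)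
  have : AddMonoidAlgebra.single x (f.coeff x) = f.coeff x • laurentMonomial R x := by
    simp [laurentMonomial]
  rw [this]
  exact Submodule.smul_mem _ _ (Submodule.subset_span
    ⟨x, fun i => ⟨h.1 i trivial, h.2 i trivial⟩, rfl⟩)

lemma map_weightedEsymm {A B : Type*} [CommRing A] [Algebra R A] [CommRing B] [Algebra R B]
    (φ : A →ₐ[R] B) (c : Finset (Fin k) → R) (y : Fin k → A) (p : ℕ) :
    φ (weightedEsymm c y p) = weightedEsymm c (fun i => φ (y i)) p := by
  simp [weightedEsymm]

/-- Polynomials embed into Laurent polynomials. -/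
lemma exists_injective_algHom_laurent (R : Type*) [CommRing R] (k : ℕ) :
    ∃ φ : MvPolynomial (Fin k) R →ₐ[R] AddMonoidAlgebra R (Fin k → ℤ),
      Function.Injective φ ∧ ∀ i, φ (X i) = laurentMonomial R (Pi.single i 1) := by
  classical
  let j : (Fin k →₀ ℕ) →+ (Fin k → ℤ) :=
    { toFun := fun x i => x i
      map_zero' := by ext; simp
      map_add' := fun x y => by ext; simp }
  have hj : Function.Injective j := fun x y h => by
    ext i
    exact Nat.cast_injective (R := ℤ) (congrFun h i)
  refine ⟨AddMonoidAlgebra.mapDomainAlgHom R R j, AddMonoidAlgebra.mapDomain_injective hj,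
    fun i => ?_⟩
  refine AddMonoidAlgebra.mapDomain_single.trans ?_
  congr 1
  ext l
  simp [j, Pi.single_apply, Finsupp.single_apply, eq_comm]

/-- A monomial in `y₀, …, y_{k-1}` with exponents `αᵢ ≤ k - i` is a combination of products of a
monomial with exponents `βᵢ ≤ k - i - 1` and a weighted elementary symmetric polynomial. -/
theorem prod_pow_mem_span_mul_span {A : Type*} [CommRing A] [Algebra R A] (y : Fin k → A)
    {c : Finset (Fin k) → R} (hc : ∀ I, IsUnit (c I)) {α : Fin k → ℕ}
    (hα : ∀ i : Fin k, α i + i ≤ k) :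
    ∏ i, y i ^ α i ∈
      Submodule.span R {m | ∃ β : Fin k → ℕ, (∀ i : Fin k, β i + i + 1 ≤ k) ∧
        m = ∏ i, y i ^ β i} *
      Submodule.span R (Set.range fun p : Fin (k + 1) => weightedEsymm c y p) := by
  obtain ⟨φ, hφ, hφX⟩ := exists_injective_algHom_laurent R k
  have hmon : ∀ β : Fin k → ℕ, φ (∏ i, X i ^ β i) = laurentMonomial R fun i => (β i : ℤ) := by
    intro β
    simp only [map_prod, map_pow, hφX]
    have : ∀ i, laurentMonomial R (Pi.single (M := fun _ : Fin k => ℤ) i 1) ^ β i =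
        laurentMonomial R (Pi.single i (β i : ℤ)) := fun i => by
      simp [laurentMonomial, AddMonoidAlgebra.single_pow, ← Pi.single_smul]
    simp only [this, laurentMonomial_prod]
    congr 1
    exact Finset.univ_sum_single _
  have hX : (∏ i, X i ^ α i : MvPolynomial (Fin k) R) ∈
      Submodule.span R {m | ∃ β : Fin k → ℕ, (∀ i : Fin k, β i + i + 1 ≤ k) ∧
        m = ∏ i, X i ^ β i} *
      Submodule.span R (Set.range fun p : Fin (k + 1) =>
        weightedEsymm c (X : Fin k → MvPolynomial (Fin k) R) p) := by
    have h := laurentMonomial_mem_laurentBox_mul_span hc (a := fun i => (α i : ℤ))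
      (fun i => by positivity) (fun i => by exact_mod_cast hα i)
    rw [← hmon] at h
    have hbox : laurentBox R Set.univ Set.univ (fun i : Fin k => (k : ℤ) - i - 1) ≤
        (Submodule.span R {m | ∃ β : Fin k → ℕ, (∀ i : Fin k, β i + i + 1 ≤ k) ∧
          m = ∏ i, X i ^ β i}).map φ.toLinearMap := by
      refine (laurentBox_univ_le_span _).trans (Submodule.span_le.2 ?_)
      rintro _ ⟨x, hx, rfl⟩
      lift x to Fin k → ℕ using fun i => (hx i).1
      refine ⟨_, Submodule.subset_span ⟨x, fun i => ?_, rfl⟩, hmon x⟩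
      have := (hx i).2
      dsimp only at this
      omega
    have hspan : Submodule.span R (Set.range fun p : Fin (k + 1) =>
          weightedEsymm c (fun i => laurentMonomial R (Pi.single i 1)) p) =
        (Submodule.span R (Set.range fun p : Fin (k + 1) =>
          weightedEsymm c (X : Fin k → MvPolynomial (Fin k) R) p)).map φ.toLinearMap := by
      rw [Submodule.map_span, ← Set.range_comp]
      simp only [Function.comp_def, AlgHom.toLinearMap_apply, map_weightedEsymm, hφX]
    have h := mul_le_mul' hbox hspan.le h
    rw [← Submodule.map_mul] at h
    obtain ⟨x, hx, hxα⟩ := h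
    rwa [← hφ hxα]
  have h := Submodule.mem_map_of_mem (f := (aeval y).toLinearMap) hX
  rw [Submodule.map_mul, Submodule.map_span, Submodule.map_span, ← Set.range_comp] at h
  simp only [Function.comp_def, AlgHom.toLinearMap_apply, map_weightedEsymm, map_prod, map_pow,
    aeval_X] at h
  refine mul_le_mul' (Submodule.span_mono ?_) le_rfl h
  rintro _ ⟨_, ⟨β, hβ, rfl⟩, rfl⟩
  exact ⟨β, hβ, by simp⟩

end Multilinear

section Staircase

variable {R A : Type*} [CommRing R] [CommRing A] [Algebra R A] {N : ℕ}

/-- The span of the monomials `∏ᵢ yᵢ ^ αᵢ` with `αᵢ ≤ k - i` (truncated subtraction). -/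
def staircaseSpan (R : Type*) {A : Type*} [CommRing R] [CommRing A] [Algebra R A] {N : ℕ}
    (y : Fin N → A) (k : ℕ) : Submodule R A :=
  Submodule.span R {m | ∃ α : Fin N → ℕ, (∀ i : Fin N, α i ≤ k - i) ∧ m = ∏ i, y i ^ α i}

/-- The polynomial `∑_{|I| = p} c_I ∏_{i ∈ I} y_i`, the sum over subsets of the first `k` indices. -/
def initialEsymm (c : Finset (Fin N) → R) (y : Fin N → A) (k p : ℕ) : A :=
  ∑ I ∈ powersetCard p (univ.filter fun i : Fin N => (i : ℕ) < k), c I • ∏ i ∈ I, y i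

lemma prod_span_range {ι : Type*} [Fintype ι] {κ : ι → Type*} (g : (i : ι) → κ i → A) :
    ∏ i, Submodule.span R (Set.range (g i)) =
      Submodule.span R (Set.range fun p : (i : ι) → κ i => ∏ i, g i (p i)) := by
  rw [Submodule.prod_span]
  congr 1
  ext a
  rw [Set.mem_fintype_prod]
  constructor
  · rintro ⟨f, hf, rfl⟩
    choose p hp using hf
    exact ⟨p, by simp [hp]⟩
  · rintro ⟨p, rfl⟩
    exact ⟨fun i => g i (p i), fun i => ⟨p i, rfl⟩, rfl⟩

lemma staircaseSpan_eq_prod (y : Fin N → A) (k : ℕ) :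
    staircaseSpan R y k =
      ∏ i : Fin N, Submodule.span R (Set.range fun j : Fin (k - i + 1) => y i ^ (j : ℕ)) := by
  rw [prod_span_range, staircaseSpan]
  congr 1
  ext a
  constructor
  · rintro ⟨α, hα, rfl⟩
    exact ⟨fun i => ⟨α i, Nat.lt_succ_of_le (hα i)⟩, rfl⟩
  · rintro ⟨p, rfl⟩
    exact ⟨fun i => p i, fun i => Nat.le_of_lt_succ (p i).2, rfl⟩

lemma span_pow_one_sub_le (a : ℕ) (y : A) :
    Submodule.span R (Set.range fun j : Fin (a + 1) => (1 - y) ^ (j : ℕ)) ≤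
      Submodule.span R (Set.range fun j : Fin (a + 1) => y ^ (j : ℕ)) := by
  refine Submodule.span_le.2 ?_
  rintro _ ⟨j, rfl⟩
  dsimp only
  rw [sub_eq_neg_add, add_pow]
  refine Submodule.sum_mem _ fun l hl => ?_
  have hl : l < a + 1 := by have := mem_range.1 hl; omega
  have : (-y) ^ l * 1 ^ ((j : ℕ) - l) * ((j : ℕ).choose l : A) =
      ((-1) ^ l * ((j : ℕ).choose l : R)) • y ^ l := by
    rw [Algebra.smul_def, neg_pow]
    push_cast [map_mul, map_pow, map_neg, map_one, map_natCast]
    ring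
  rw [this]
  exact Submodule.smul_mem _ _ (Submodule.subset_span ⟨⟨l, hl⟩, rfl⟩)

lemma staircaseSpan_one_sub (y : Fin N → A) (k : ℕ) :
    staircaseSpan R (fun i => 1 - y i) k = staircaseSpan R y k := by
  simp only [staircaseSpan_eq_prod]
  refine prod_congr rfl fun i _ => le_antisymm (span_pow_one_sub_le _ _) ?_
  simpa using span_pow_one_sub_le (R := R) (k - i) (1 - y i)

lemma filter_lt_eq_map_castLEEmb {k : ℕ} (hk : k ≤ N) :
    (univ.filter fun i : Fin N => (i : ℕ) < k) = univ.map (Fin.castLEEmb hk) := by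
  ext i
  simp only [mem_filter, mem_univ, true_and, mem_map, Fin.castLEEmb_apply]
  exact ⟨fun h => ⟨⟨i, h⟩, rfl⟩, by rintro ⟨j, rfl⟩; exact j.2⟩

lemma initialEsymm_eq_weightedEsymm (c : Finset (Fin N) → R) (y : Fin N → A) {k : ℕ} (hk : k ≤ N)
    (p : ℕ) : initialEsymm c y k p =
      weightedEsymm (fun I => c (I.map (Fin.castLEEmb hk))) (fun i => y (Fin.castLE hk i)) p := by
  simp [initialEsymm, weightedEsymm, filter_lt_eq_map_castLEEmb hk, powersetCard_map, sum_map]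

lemma prod_eq_prod_castLE {k : ℕ} (hk : k ≤ N) {f : Fin N → A} (hf : ∀ i : Fin N, k ≤ i → f i = 1) :
    ∏ i, f i = ∏ i, f (Fin.castLE hk i) := by
  rw [← prod_subset (subset_univ (univ.filter fun i : Fin N => (i : ℕ) < k)),
    filter_lt_eq_map_castLEEmb hk, prod_map]
  · simp
  · intro i _ hi
    exact hf i (by simpa using hi)

/-- Multiplying the staircase of height `k` by the forms `∑_{|I| = p} c_I ∏_{i ∈ I} y_i` in the
first `k + 1` variables gives the staircase of height `k + 1`. -/
theorem staircaseSpan_mul_span_initialEsymm (y : Fin N → A) {c : Finset (Fin N) → R}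
    (hc : ∀ I, IsUnit (c I)) {k : ℕ} (hk : k + 1 ≤ N) :
    staircaseSpan R y k *
      Submodule.span R (Set.range fun p : Fin (k + 2) => initialEsymm c y (k + 1) p) =
      staircaseSpan R y (k + 1) := by
  refine le_antisymm ?_ (Submodule.span_le.2 ?_)
  · rw [staircaseSpan, Submodule.span_mul_span, Submodule.span_le]
    rintro _ ⟨_, ⟨α, hα, rfl⟩, _, ⟨p, rfl⟩, rfl⟩
    dsimp only [initialEsymm]
    rw [mul_sum]
    refine Submodule.sum_mem _ fun I hI => ?_
    rw [mul_smul_comm]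
    refine Submodule.smul_mem _ _ (Submodule.subset_span
      ⟨fun i => α i + if i ∈ I then 1 else 0, fun i => ?_, ?_⟩)
    · have := hα i
      dsimp only
      split_ifs with h
      · have := (mem_filter.1 ((mem_powersetCard.1 hI).1 h)).2
        omega
      · omega
    · have : ∏ i ∈ I, y i = ∏ i, y i ^ (if i ∈ I then 1 else 0) := by simp [pow_ite]
      rw [this, ← prod_mul_distrib]
      simp only [pow_add]
  · rintro _ ⟨α, hα, rfl⟩
    rw [prod_eq_prod_castLE hk fun i hi => by
      have := hα i
      rw [show α i = 0 by omega, pow_zero]]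
    have h := prod_pow_mem_span_mul_span (fun i => y (Fin.castLE hk i))
      (fun I => hc (I.map (Fin.castLEEmb hk))) (α := fun i => α (Fin.castLE hk i)) (fun i => by
        have := hα (Fin.castLE hk i)
        rw [Fin.val_castLE] at this
        omega)
    simp only [← initialEsymm_eq_weightedEsymm] at h
    refine mul_le_mul' (Submodule.span_mono ?_) le_rfl h
    rintro _ ⟨β, hβ, rfl⟩
    refine ⟨fun i => if h : (i : ℕ) < k + 1 then β ⟨i, h⟩ else 0, fun i => ?_, ?_⟩
    · dsimp only
      split_ifs with h
      · have := hβ ⟨i, h⟩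
        dsimp only at this
        omega
      · omega
    · rw [prod_eq_prod_castLE hk fun i hi => by simp only [dif_neg (not_lt.2 hi), pow_zero]]
      exact prod_congr rfl fun i _ => by simp only [Fin.val_castLE, i.2, dif_pos, Fin.eta]

lemma staircaseSpan_zero (y : Fin N → A) : staircaseSpan R y 0 = 1 := by
  rw [staircaseSpan, Submodule.one_eq_span]
  congr 1
  ext a
  simp [← funext_iff]

theorem prod_span_initialEsymm (y : Fin N → A) {c : Finset (Fin N) → R} (hc : ∀ I, IsUnit (c I)) :
    ∏ i : Fin N, Submodule.span R (Set.range fun p : Fin (i + 2) => initialEsymm c y (i + 1) p) =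
      staircaseSpan R y N := by
  rw [Fin.prod_univ_eq_prod_range (fun i => Submodule.span R (Set.range fun p : Fin (i + 2) =>
    initialEsymm c y (i + 1) p))]
  suffices h : ∀ k ≤ N, ∏ i ∈ range k, Submodule.span R (Set.range fun p : Fin (i + 2) =>
      initialEsymm c y (i + 1) p) = staircaseSpan R y k from h N le_rfl
  intro k hk
  induction k with
  | zero => rw [prod_range_zero, staircaseSpan_zero]
  | succ k ih => rw [prod_range_succ, ih (by omega), staircaseSpan_mul_span_initialEsymm y hc hk]

end Staircase

lemma staircaseSpan_X_eq_Lmod (n : ℕ) :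
    staircaseSpan (QRing n) (X : Fin (n - 1) → PolyR n) (n - 1) = Lmod n := by
  rw [staircaseSpan, Lmod]
  congr 1
  ext m
  refine exists_congr fun α => and_congr_left fun _ => forall_congr' fun i => ?_
  omega

/-- The coefficient of `∏_{i ∈ I} (1 - x_i)` in `F_p^k`. -/
def coeffFR (n : ℕ) (I : Finset (Fin (n - 1))) : QRing n :=
  ∏ i ∈ I.filter (fun i : Fin (n - 1) => ¬ ∃ j ∈ I, (j : ℕ) = (i : ℕ) + 1),
    algebraMap (QPoly n) (QRing n) (1 - X i)

lemma isUnit_coeffFR (n : ℕ) (I : Finset (Fin (n - 1))) : IsUnit (coeffFR n I) := by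
  refine IsUnit.prod_iff.2 fun i _ => ?_
  exact IsLocalization.map_units (QRing n)
    (⟨1 - X i, Submonoid.subset_closure ⟨i, rfl⟩⟩ : qSubmonoid n)

lemma FR_eq_initialEsymm (n : ℕ) {p k : ℕ} (hp : p ≤ k) :
    FR n p k = initialEsymm (coeffFR n) (fun i => 1 - X i : Fin (n - 1) → PolyR n) k p := by
  rw [FR, if_pos hp, initialEsymm]
  refine sum_congr rfl fun I _ => ?_
  rw [MvPolynomial.smul_eq_C_mul, coeffFR, map_prod, mul_comm]
  congr 1
  refine prod_congr rfl fun i _ => ?_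
  simp [qC]

theorem span_range_famF (n : ℕ) : Submodule.span (QRing n) (Set.range (famF n)) = Lmod n := by
  rw [← staircaseSpan_X_eq_Lmod, ← staircaseSpan_one_sub,
    ← prod_span_initialEsymm _ (isUnit_coeffFR n), prod_span_range]
  congr 2
  ext1 p
  exact prod_congr rfl fun i _ => FR_eq_initialEsymm n (by omega)

lemma finrank_Lmod (n : ℕ) [Nontrivial (QRing n)] :
    Module.finrank (QRing n) (Lmod n) = ∏ i : Fin (n - 1), (n - i) := by
  have hinj : Function.Injective fun α : (i : Fin (n - 1)) → Fin (n - i) =>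
      Finsupp.equivFunOnFinite.symm fun i => (α i : ℕ) := fun α β h => by
    ext i
    exact congrFun (Finsupp.equivFunOnFinite.symm.injective h) i
  have hli := (basisMonomials (Fin (n - 1)) (QRing n)).linearIndependent.comp _ hinj
  have h := finrank_span_eq_card hli
  rw [Fintype.card_pi] at h
  simp only [Fintype.card_fin] at h
  rw [← h, Lmod]
  suffices hs : {m : PolyR n | ∃ α : Fin (n - 1) → ℕ,
      (∀ i : Fin (n - 1), α i + ((i : ℕ) + 1) ≤ n) ∧ m = ∏ i : Fin (n - 1), X i ^ α i} =
      Set.range (basisMonomials (Fin (n - 1)) (QRing n) ∘ _) by rw [hs]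
  ext m
  constructor
  · rintro ⟨α, hα, rfl⟩
    refine ⟨fun i => ⟨α i, by have := hα i; omega⟩, ?_⟩
    simp [monomial_eq, Finsupp.prod_fintype]
  · rintro ⟨α, rfl⟩
    refine ⟨fun i => α i, fun i => ?_, ?_⟩
    · have := (α i).2
      dsimp only
      omega
    · simp [monomial_eq, Finsupp.prod_fintype]

lemma prod_sub_val_eq_prod_val_add_two (n : ℕ) :
    ∏ i : Fin (n - 1), (n - i) = ∏ i : Fin (n - 1), ((i : ℕ) + 2) := by
  rw [← Equiv.prod_comp Fin.revPerm]
  refine prod_congr rfl fun i _ => ?_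
  rw [Fin.revPerm_apply, Fin.val_rev]
  omega

/-- The products `F_{p_1}^1·⋯·F_{p_{n−1}}^{n−1}` (`0 ≤ p_i ≤ i`) form an `R`-basis of the
`R`-submodule `L_n^R`: they are linearly independent over `R` and span `L_n^R`. -/
theorem statement17 (n : ℕ) (hn : 1 ≤ n) :
    LinearIndependent (QRing n) (famF n) ∧
      Submodule.span (QRing n) (Set.range (famF n)) = Lmod n := by
  refine ⟨?_, span_range_famF n⟩
  rcases subsingleton_or_nontrivial (QRing n) with _ | _
  · exact linearIndependent_of_subsingleton
  · rw [linearIndependent_iff_card_eq_finrank_span, Set.finrank, span_range_famF, finrank_Lmod,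
      prod_sub_val_eq_prod_val_add_two, Fintype.card_pi]
    simp
end
end
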